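/- Let Φ be a partially monotone norm on ℝ^{n+1}, Ω̂ ⊆ ℝ^n an open set, and u ∈ BV_loc(Ω̂). If u is a minimizer of G_{Φ^o} in Ω̂, then the subgraph sg(u) is a minimizer of P_Φ in Ω̂ × ℝ. -/

import Mathlib

open MeasureTheory Set Filter

noncomputable section

/-- `ℝ^n` with the Euclidean norm. -/
abbrev Rn (n : ℕ) := EuclideanSpace ℝ (Fin n)

/-- `ℝ^{n+1} = ℝ^n × ℝ`. -/
abbrev Rn1 (n : ℕ) := Rn n × ℝ

/-- Euclidean dot product on `ℝ^n`. -/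
def dotn {n : ℕ} (x y : Rn n) : ℝ := ∑ i, x i * y i

/-- Euclidean dot product on `ℝ^{n+1} = ℝ^n × ℝ`. -/
def dotp {n : ℕ} (x y : Rn1 n) : ℝ := dotn x.1 y.1 + x.2 * y.2

/-- Euclidean norm on `ℝ^{n+1} = ℝ^n × ℝ`. -/
def enorm1 {n : ℕ} (x : Rn1 n) : ℝ := Real.sqrt (dotp x x)

/-- `Ψ` is a norm on `ℝ^n`: convex, absolutely one-homogeneous and bounded
below by a positive multiple of the Euclidean norm. -/
def IsNormN {n : ℕ} (Ψ : Rn n → ℝ) : Prop :=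
  ConvexOn ℝ univ Ψ ∧ (∀ (c : ℝ) (ξ : Rn n), Ψ (c • ξ) = |c| * Ψ ξ) ∧
    ∃ c > (0:ℝ), ∀ ξ, c * ‖ξ‖ ≤ Ψ ξ

/-- `Φ` is a norm on `ℝ^{n+1}`. -/
def IsNorm1 {n : ℕ} (Φ : Rn1 n → ℝ) : Prop :=
  ConvexOn ℝ univ Φ ∧ (∀ (c : ℝ) (ξ : Rn1 n), Φ (c • ξ) = |c| * Φ ξ) ∧
    ∃ c > (0:ℝ), ∀ ξ, c * enorm1 ξ ≤ Φ ξ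

/-- Dual norm on `ℝ^n`: `Ψ^o(ξ*) = sup {ξ*·ξ : Ψ(ξ) ≤ 1}`. -/
def dualN {n : ℕ} (Ψ : Rn n → ℝ) (xs : Rn n) : ℝ :=
  sSup ((fun ξ => dotn xs ξ) '' {ξ | Ψ ξ ≤ 1})

/-- Dual norm on `ℝ^{n+1}`. -/
def dual1 {n : ℕ} (Φ : Rn1 n → ℝ) (xs : Rn1 n) : ℝ :=
  sSup ((fun ξ => dotp xs ξ) '' {ξ | Φ ξ ≤ 1})

/-- `Φ` is cylindrical over `φ`: `Φ(ξ̂,ξ_{n+1}) = max (φ(ξ̂), |ξ_{n+1}|)`. -/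
def Cylindrical {n : ℕ} (Φ : Rn1 n → ℝ) (φ : Rn n → ℝ) : Prop :=
  ∀ ξ : Rn1 n, Φ ξ = max (φ ξ.1) |ξ.2|

/-- `A` is an open set compactly contained in `O`. -/
def CpCtd {E : Type*} [TopologicalSpace E] (A O : Set E) : Prop :=
  IsOpen A ∧ IsCompact (closure A) ∧ closure A ⊆ O

/-- Divergence of a vector field on `ℝ^n`. -/
def divN {n : ℕ} (η : Rn n → Rn n) (x : Rn n) : ℝ :=
  ∑ i, fderiv ℝ η x (EuclideanSpace.single i (1:ℝ)) i

/-- Divergence of a vector field on `ℝ^{n+1} = ℝ^n × ℝ`. -/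
def div1 {n : ℕ} (η : Rn1 n → Rn1 n) (z : Rn1 n) : ℝ :=
  (∑ i, (fderiv ℝ η z (EuclideanSpace.single i (1:ℝ), (0:ℝ))).1 i) +
    (fderiv ℝ η z ((0 : Rn n), (1:ℝ))).2

/-- Admissible test vector fields on `ℝ^n`: `C^1`, compactly supported in `A`,
with values in the unit ball of `Ψ`. -/
def TestN {n : ℕ} (A : Set (Rn n)) (Ψ : Rn n → ℝ) (η : Rn n → Rn n) : Prop :=
  ContDiff ℝ 1 η ∧ HasCompactSupport η ∧ tsupport η ⊆ A ∧ ∀ x, Ψ (η x) ≤ 1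

/-- Admissible test vector fields on `ℝ^{n+1}`. -/
def Test1 {n : ℕ} (A : Set (Rn1 n)) (Φ : Rn1 n → ℝ) (η : Rn1 n → Rn1 n) : Prop :=
  ContDiff ℝ 1 η ∧ HasCompactSupport η ∧ tsupport η ⊆ A ∧ ∀ z, Φ (η z) ≤ 1

/-- The set of numbers whose supremum is the anisotropic perimeter `P_Ψ(E,A)` in `ℝ^n`. -/
def perSetN {n : ℕ} (Ψ : Rn n → ℝ) (E A : Set (Rn n)) : Set ℝ :=
  {r | ∃ η, TestN A Ψ η ∧ r = -∫ x in E, divN η x}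

/-- Anisotropic perimeter `P_Ψ(E,A)` in `ℝ^n`. -/
def PerN {n : ℕ} (Ψ : Rn n → ℝ) (E A : Set (Rn n)) : ℝ := sSup (perSetN Ψ E A)

/-- `E` has locally finite perimeter in `O ⊆ ℝ^n`. -/
def BVlocSetN {n : ℕ} (O E : Set (Rn n)) : Prop :=
  ∀ A, CpCtd A O → BddAbove (perSetN (fun x => ‖x‖) E A)

/-- `E` is a minimizer of `P_Ψ` (by compact perturbations) in `O ⊆ ℝ^n`. -/
def MinPerN {n : ℕ} (Ψ : Rn n → ℝ) (O E : Set (Rn n)) : Prop :=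
  BVlocSetN O E ∧ ∀ A, CpCtd A O → ∀ F, BVlocSetN O F →
    IsCompact (closure (symmDiff E F)) → closure (symmDiff E F) ⊆ A →
      PerN Ψ E A ≤ PerN Ψ F A

/-- The set of numbers whose supremum is the anisotropic perimeter `P_Φ(E,A)` in `ℝ^{n+1}`. -/
def perSet1 {n : ℕ} (Φ : Rn1 n → ℝ) (E A : Set (Rn1 n)) : Set ℝ :=
  {r | ∃ η, Test1 A Φ η ∧ r = -∫ z in E, div1 η z}

/-- Anisotropic perimeter `P_Φ(E,A)` in `ℝ^{n+1}`. -/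
def Per1 {n : ℕ} (Φ : Rn1 n → ℝ) (E A : Set (Rn1 n)) : ℝ := sSup (perSet1 Φ E A)

/-- `E` has locally finite perimeter in `O ⊆ ℝ^{n+1}`. -/
def BVlocSet1 {n : ℕ} (O E : Set (Rn1 n)) : Prop :=
  ∀ A, CpCtd A O → BddAbove (perSet1 enorm1 E A)

/-- `E` is a minimizer of `P_Φ` (by compact perturbations) in `O ⊆ ℝ^{n+1}`. -/
def MinPer1 {n : ℕ} (Φ : Rn1 n → ℝ) (O E : Set (Rn1 n)) : Prop :=
  BVlocSet1 O E ∧ ∀ A, CpCtd A O → ∀ F, BVlocSet1 O F →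
    IsCompact (closure (symmDiff E F)) → closure (symmDiff E F) ⊆ A →
      Per1 Φ E A ≤ Per1 Φ F A

/-- The set of numbers whose supremum is the total variation `TV(u,A)`. -/
def varSet {n : ℕ} (A : Set (Rn n)) (u : Rn n → ℝ) : Set ℝ :=
  {r | ∃ η, TestN A (fun x => ‖x‖) η ∧ r = ∫ x in A, u x * divN η x}

/-- Total variation `TV(u,A)`. -/
def TV {n : ℕ} (u : Rn n → ℝ) (A : Set (Rn n)) : ℝ := sSup (varSet A u)

/-- `u ∈ BV_loc(Ω̂)`. -/
def BVlocFun {n : ℕ} (Ω : Set (Rn n)) (u : Rn n → ℝ) : Prop :=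
  (∀ A, CpCtd A Ω → IntegrableOn u A) ∧ ∀ A, CpCtd A Ω → BddAbove (varSet A u)

/-- The set of numbers whose supremum is `G_{Φ^o}(u,A)`. -/
def Gset {n : ℕ} (Φ : Rn1 n → ℝ) (A : Set (Rn n)) (u : Rn n → ℝ) : Set ℝ :=
  {r | ∃ η : Rn n → Rn1 n, ContDiff ℝ 1 η ∧ HasCompactSupport η ∧ tsupport η ⊆ A ∧
    (∀ x, Φ (η x) ≤ 1) ∧ r = ∫ x in A, (u x * divN (fun y => (η y).1) x + (η x).2)}

/-- The functional `G_{Φ^o}(u,A)`. -/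
def Gfun {n : ℕ} (Φ : Rn1 n → ℝ) (u : Rn n → ℝ) (A : Set (Rn n)) : ℝ := sSup (Gset Φ A u)

/-- `w` has compact support contained in `A`. -/
def CptSupp {n : ℕ} (A : Set (Rn n)) (w : Rn n → ℝ) : Prop :=
  IsCompact (tsupport w) ∧ tsupport w ⊆ A

/-- `u` is a minimizer of `G_{Φ^o}` by compact perturbations in `Ω̂`,
i.e. `u ∈ M_{Φ^o}(Ω̂)`. -/
def MinG {n : ℕ} (Φ : Rn1 n → ℝ) (Ω : Set (Rn n)) (u : Rn n → ℝ) : Prop :=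
  BVlocFun Ω u ∧ ∀ A, CpCtd A Ω → ∀ v, BVlocFun Ω v →
    CptSupp A (fun x => u x - v x) → Gfun Φ u A ≤ Gfun Φ v A

/-- `u` is a minimizer of the total variation by compact perturbations in `Ω̂`. -/
def MinTV {n : ℕ} (Ω : Set (Rn n)) (u : Rn n → ℝ) : Prop :=
  BVlocFun Ω u ∧ ∀ A, CpCtd A Ω → ∀ v, BVlocFun Ω v →
    CptSupp A (fun x => u x - v x) → TV u A ≤ TV v A

/-- Subgraph of `u : Ω̂ → ℝ`. -/
def sg {n : ℕ} (Ω : Set (Rn n)) (u : Rn n → ℝ) : Set (Rn1 n) :=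
  {p | p.1 ∈ Ω ∧ p.2 < u p.1}

/-- `S` is locally a Lipschitz graph at `p`. -/
def IsLocLipGraphAt {n : ℕ} (S : Set (Rn1 n)) (p : Rn1 n) : Prop :=
  ∃ U : Set (Rn1 n), IsOpen U ∧ p ∈ U ∧ ∃ e : Rn1 n, enorm1 e = 1 ∧
    ∃ g : Rn1 n → ℝ, (∃ L : NNReal, LipschitzOnWith L g {y | dotp y e = 0}) ∧
      S ∩ U = {z | ∃ y, dotp y e = 0 ∧ z = y + g y • e} ∩ U

/-- `Φ` is a partially monotone norm on `ℝ^{n+1}`. -/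
def PartMono {n : ℕ} (Φ : Rn1 n → ℝ) : Prop :=
  ∀ ξ η : Rn1 n, Φ (ξ.1, 0) ≤ Φ (η.1, 0) → Φ ((0 : Rn n), ξ.2) ≤ Φ ((0 : Rn n), η.2) →
    Φ ξ ≤ Φ η

end


open MeasureTheory Set Filter
open scoped Topology

theorem div1_continuous {n : ℕ} {η : Rn1 n → Rn1 n} (h : ContDiff ℝ 1 η) :
    Continuous (div1 η) := by
  have := h.continuous_fderiv one_ne_zero
  unfold div1
  refine Continuous.add (continuous_finsetSum _ fun i _ => ?_) ?_
  · have h1 : Continuous fun z => (fderiv ℝ η z (EuclideanSpace.single i (1:ℝ), (0:ℝ))).1 := by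
      fun_prop
    exact (EuclideanSpace.proj (𝕜 := ℝ) i).continuous.comp h1
  · fun_prop

theorem divN_continuous {n : ℕ} {η : Rn n → Rn n} (h : ContDiff ℝ 1 η) :
    Continuous (divN η) := by
  have := h.continuous_fderiv one_ne_zero
  unfold divN
  refine (continuous_finsetSum _ fun i _ => ?_)
  have h1 : Continuous fun z => (fderiv ℝ η z (EuclideanSpace.single i (1:ℝ))) := by
      fun_prop
  exact (EuclideanSpace.proj (𝕜 := ℝ) i).continuous.comp h1

theorem div1_zero_of_notMem {n : ℕ} {η : Rn1 n → Rn1 n} {z : Rn1 n} (hz : z ∉ tsupport η) :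
    div1 η z = 0 := by
  simp [div1, fderiv_of_notMem_tsupport ℝ hz]

theorem divN_zero_of_notMem {n : ℕ} {η : Rn n → Rn n} {z : Rn n} (hz : z ∉ tsupport η) :
    divN η z = 0 := by
  simp [divN, fderiv_of_notMem_tsupport ℝ hz]

theorem div1_hasCompactSupport {n : ℕ} {η : Rn1 n → Rn1 n} (h : HasCompactSupport η) :
    HasCompactSupport (div1 η) :=
  HasCompactSupport.intro h fun _ hz => div1_zero_of_notMem hz

theorem divN_hasCompactSupport {n : ℕ} {η : Rn n → Rn n} (h : HasCompactSupport η) :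
    HasCompactSupport (divN η) :=
  HasCompactSupport.intro h fun _ hz => divN_zero_of_notMem hz

theorem div1_integrable {n : ℕ} {η : Rn1 n → Rn1 n} (h : ContDiff ℝ 1 η)
    (hc : HasCompactSupport η) : Integrable (div1 η) :=
  (div1_continuous h).integrable_of_hasCompactSupport (div1_hasCompactSupport hc)

theorem divN_integrable {n : ℕ} {η : Rn n → Rn n} (h : ContDiff ℝ 1 η)
    (hc : HasCompactSupport η) : Integrable (divN η) :=
  (divN_continuous h).integrable_of_hasCompactSupport (divN_hasCompactSupport hc)

theorem div1_add {n : ℕ} {η θ : Rn1 n → Rn1 n} (h : ContDiff ℝ 1 η) (h' : ContDiff ℝ 1 θ) :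
    div1 (fun z => η z + θ z) = fun z => div1 η z + div1 θ z := by
  funext z
  have h1 := (h.differentiable one_ne_zero) z
  have h2 := (h'.differentiable one_ne_zero) z
  simp only [div1, fderiv_fun_add h1 h2, add_apply, Prod.fst_add, Prod.snd_add,
    PiLp.add_apply, Finset.sum_add_distrib]
  ring

theorem div1_smul {n : ℕ} {η : Rn1 n → Rn1 n} (h : ContDiff ℝ 1 η) (c : ℝ) :
    div1 (fun z => c • η z) = fun z => c * div1 η z := by
  funext z
  have h1 := (h.differentiable one_ne_zero) z
  simp only [div1, fderiv_fun_const_smul h1, smul_apply, Prod.smul_fst,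
    Prod.smul_snd, PiLp.smul_apply, smul_eq_mul, ← Finset.mul_sum]
  ring

theorem divN_smul {n : ℕ} {η : Rn n → Rn n} (h : ContDiff ℝ 1 η) (c : ℝ) :
    divN (fun z => c • η z) = fun z => c * divN η z := by
  funext z
  have h1 := (h.differentiable one_ne_zero) z
  simp only [divN, fderiv_fun_const_smul h1, smul_apply,
    PiLp.smul_apply, smul_eq_mul, ← Finset.mul_sum]

/-- The distributional functional. -/
noncomputable def DD {n : ℕ} (E : Set (Rn1 n)) (η : Rn1 n → Rn1 n) : ℝ := -∫ z in E, div1 η z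

theorem DD_add {n : ℕ} {η θ : Rn1 n → Rn1 n} (E : Set (Rn1 n)) (h : ContDiff ℝ 1 η)
    (h' : ContDiff ℝ 1 θ) (hc : HasCompactSupport η) (hc' : HasCompactSupport θ) :
    DD E (fun z => η z + θ z) = DD E η + DD E θ := by
  unfold DD
  rw [div1_add h h', integral_add (div1_integrable h hc).integrableOn
    (div1_integrable h' hc').integrableOn]
  ring

theorem DD_smul {n : ℕ} {η : Rn1 n → Rn1 n} (E : Set (Rn1 n)) (h : ContDiff ℝ 1 η) (c : ℝ) :
    DD E (fun z => c • η z) = c * DD E η := by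
  unfold DD
  rw [div1_smul h, integral_const_mul]
  ring

theorem DD_congr {n : ℕ} {E F K : Set (Rn1 n)} (hK : MeasurableSet K) (hEF : E \ K = F \ K)
    {η : Rn1 n → Rn1 n} (h : ContDiff ℝ 1 η) (hc : HasCompactSupport η)
    (hd : Disjoint (tsupport η) K) : DD E η = DD F η := by
  have key : ∀ S : Set (Rn1 n), ∫ z in S, div1 η z = ∫ z in S \ K, div1 η z := by
    intro S
    rw [← integral_inter_add_sdiff hK (div1_integrable h hc).integrableOn,
      setIntegral_eq_zero_of_forall_eq_zero, zero_add]
    intro z hz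
    exact div1_zero_of_notMem fun hz' => disjoint_left.1 hd hz' hz.2
  unfold DD
  rw [key E, key F, hEF]

theorem norm1_zero {n : ℕ} {Φ : Rn1 n → ℝ} (h : IsNorm1 Φ) : Φ 0 = 0 := by
  have := h.2.1 0 0
  simpa using this

theorem norm_le_enorm1 {n : ℕ} (x : Rn1 n) : ‖x‖ ≤ enorm1 x := by
  have h1 : dotn x.1 x.1 = ‖x.1‖^2 := by
    rw [EuclideanSpace.norm_sq_eq]; simp [dotn, sq]
  unfold enorm1 dotp
  rw [h1]
  apply Real.le_sqrt_of_sq_le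
  rw [Prod.norm_def]
  rcases max_choice ‖x.1‖ ‖x.2‖ with h | h <;> rw [h]
  · nlinarith [sq_nonneg x.2]
  · rw [Real.norm_eq_abs, sq_abs]; nlinarith [sq_nonneg ‖x.1‖]

theorem enorm1_le {n : ℕ} (x : Rn1 n) : enorm1 x ≤ ‖x.1‖ + |x.2| := by
  have h1 : dotn x.1 x.1 = ‖x.1‖^2 := by
    rw [EuclideanSpace.norm_sq_eq]; simp [dotn, sq]
  unfold enorm1 dotp
  rw [h1]
  apply Real.sqrt_le_iff.2 ⟨by positivity, ?_⟩
  have := sq_abs x.2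
  nlinarith [mul_nonneg (norm_nonneg x.1) (abs_nonneg x.2)]

theorem enorm1_smul {n : ℕ} (c : ℝ) (x : Rn1 n) : enorm1 (c • x) = |c| * enorm1 x := by
  have : dotp (c • x) (c • x) = c ^ 2 * dotp x x := by
    simp only [dotp, dotn, Prod.smul_fst, PiLp.smul_apply, smul_eq_mul, Prod.smul_snd, mul_add,
      Finset.mul_sum]
    congr 1
    · exact Finset.sum_congr rfl fun i _ => by ring
    · ring
  unfold enorm1
  rw [this, Real.sqrt_mul (sq_nonneg c), Real.sqrt_sq_eq_abs]

theorem norm1_lower {n : ℕ} {Φ : Rn1 n → ℝ} (h : IsNorm1 Φ) :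
    ∃ c > (0:ℝ), ∀ ξ, Φ ξ ≤ 1 → enorm1 (c • ξ) ≤ 1 := by
  obtain ⟨c, hc, hb⟩ := h.2.2
  refine ⟨c, hc, fun ξ hξ => ?_⟩
  rw [enorm1_smul, abs_of_pos hc]
  exact (hb ξ).trans hξ

theorem norm1_upper {n : ℕ} {Φ : Rn1 n → ℝ} (h : IsNorm1 Φ) :
    ∃ c > (0:ℝ), ∀ ξ, enorm1 ξ ≤ 1 → Φ (c • ξ) ≤ 1 := by
  have hcont : Continuous Φ := h.1.locallyLipschitz.continuous
  have h0 : ∀ᶠ ξ in 𝓝 (0 : Rn1 n), Φ ξ < 1 := by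
    apply hcont.continuousAt.eventually_lt continuousAt_const
    rw [norm1_zero h]; norm_num
  obtain ⟨r, hr, hb⟩ := Metric.eventually_nhds_iff.1 h0
  refine ⟨r / 2, by positivity, fun ξ hξ => (hb ?_).le⟩
  rw [dist_zero_right, norm_smul, Real.norm_eq_abs, abs_of_pos (by positivity)]
  have := (norm_le_enorm1 ξ).trans hξ
  nlinarith

theorem bdd_scale {n : ℕ} {Φ Ψ : Rn1 n → ℝ} {c : ℝ} (hc : 0 < c)
    (h : ∀ ξ, Ψ ξ ≤ 1 → Φ (c • ξ) ≤ 1) {E A : Set (Rn1 n)} (hb : BddAbove (perSet1 Φ E A)) :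
    BddAbove (perSet1 Ψ E A) := by
  obtain ⟨M, hM⟩ := hb
  refine ⟨M / c, ?_⟩
  rintro r ⟨η, ⟨h1, h2, h3, h4⟩, rfl⟩
  have hs : Test1 A Φ (fun z => c • η z) := by
    have ts : tsupport (fun z => c • η z) ⊆ tsupport η :=
      closure_mono (Function.support_const_smul_subset c η)
    exact ⟨h1.const_smul c, h2.mono (Function.support_const_smul_subset c η), ts.trans h3,
      fun z => h _ (h4 z)⟩
  have := hM ⟨_, hs, rfl⟩
  change DD E η ≤ _
  change DD E _ ≤ _ at this
  rw [DD_smul E h1] at this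
  rw [le_div_iff₀ hc]; linarith

theorem Test1.mono {n : ℕ} {A B : Set (Rn1 n)} {Φ : Rn1 n → ℝ} {η : Rn1 n → Rn1 n} (hAB : A ⊆ B)
    (h : Test1 A Φ η) : Test1 B Φ η := ⟨h.1, h.2.1, h.2.2.1.trans hAB, h.2.2.2⟩

theorem perSet1_mono {n : ℕ} {A B : Set (Rn1 n)} {Φ : Rn1 n → ℝ} {E : Set (Rn1 n)}
    (hAB : A ⊆ B) : perSet1 Φ E A ⊆ perSet1 Φ E B := by
  rintro r ⟨η, h, rfl⟩
  exact ⟨η, h.mono hAB, rfl⟩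

open MeasureTheory Set Filter
open scoped Topology

theorem tsupport_smul_left {n : ℕ} (χ : Rn1 n → ℝ) (η : Rn1 n → Rn1 n) :
    tsupport (fun z => χ z • η z) ⊆ tsupport χ ∩ tsupport η :=
  subset_inter (closure_mono fun z hz hz' => hz (by simp [hz']))
    (closure_mono fun z hz hz' => hz (by simp [hz']))

theorem norm1_smul_le {n : ℕ} {Φ : Rn1 n → ℝ} (h : IsNorm1 Φ) {c : ℝ} (hc : c ∈ Icc (0:ℝ) 1)
    {ξ : Rn1 n} (hξ : Φ ξ ≤ 1) : Φ (c • ξ) ≤ 1 := by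
  rw [h.2.1, abs_of_nonneg hc.1]
  by_cases h0 : 0 ≤ Φ ξ
  · nlinarith [hc.1, hc.2]
  · nlinarith [hc.1, hc.2, mul_nonneg hc.1 (by linarith : 0 ≤ - Φ ξ)]

theorem Test1.cut {n : ℕ} {Φ : Rn1 n → ℝ} (hΦ : IsNorm1 Φ) {A B : Set (Rn1 n)}
    {η : Rn1 n → Rn1 n} (h : Test1 A Φ η) {χ : Rn1 n → ℝ} (hχ : ContDiff ℝ 1 χ)
    (h01 : ∀ z, χ z ∈ Icc (0:ℝ) 1) (hB : tsupport χ ∩ A ⊆ B) :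
    Test1 B Φ (fun z => χ z • η z) := by
  have hs := tsupport_smul_left χ η
  refine ⟨hχ.smul h.1, ?_, ?_, fun z => norm1_smul_le hΦ (h01 z) (h.2.2.2 z)⟩
  · exact h.2.1.of_isClosed_subset (isClosed_tsupport _) (hs.trans inter_subset_right)
  · exact hs.trans ((inter_subset_inter_right _ h.2.2.1).trans hB)

theorem Test1.add {n : ℕ} {Φ : Rn1 n → ℝ} {A : Set (Rn1 n)}
    {η θ : Rn1 n → Rn1 n} (h : Test1 A Φ η) (h' : Test1 A Φ θ)
    (hd : Disjoint (tsupport η) (tsupport θ)) :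
    Test1 A Φ (fun z => η z + θ z) := by
  refine ⟨h.1.add h'.1, h.2.1.add h'.2.1, (tsupport_add η θ).trans (union_subset h.2.2.1 h'.2.2.1),
    fun z => ?_⟩
  by_cases hz : z ∈ tsupport η
  · simpa [image_eq_zero_of_notMem_tsupport (disjoint_left.1 hd hz)] using h.2.2.2 z
  · simpa [image_eq_zero_of_notMem_tsupport hz] using h'.2.2.2 z

theorem Test1.zero {n : ℕ} {Φ : Rn1 n → ℝ} (hΦ : IsNorm1 Φ) (A : Set (Rn1 n)) :
    Test1 A Φ (fun _ => 0) := by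
  refine ⟨contDiff_const, HasCompactSupport.zero, ?_, fun z => by simp [norm1_zero hΦ]⟩
  have : tsupport (fun _ : Rn1 n => (0 : Rn1 n)) = ∅ := by simp
  rw [this]; exact empty_subset _

theorem near_opt {n : ℕ} {Φ : Rn1 n → ℝ} (hΦ : IsNorm1 Φ) {E A : Set (Rn1 n)}
    (hb : BddAbove (perSet1 Φ E A)) {ε : ℝ} (hε : 0 < ε) :
    ∃ θ, Test1 A Φ θ ∧ ∀ η, Test1 A Φ η → DD E η ≤ DD E θ + ε := by
  have hne : (perSet1 Φ E A).Nonempty := ⟨_, _, Test1.zero hΦ A, rfl⟩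
  obtain ⟨r, ⟨θ, hθ, rfl⟩, hr⟩ := exists_lt_of_lt_csSup hne (sub_lt_self (sSup (perSet1 Φ E A)) hε)
  refine ⟨θ, hθ, fun η hη => ?_⟩
  have := le_csSup hb ⟨η, hη, rfl⟩
  change DD E η ≤ _ at this
  change _ < DD E θ at hr
  linarith

theorem exists_cut {n : ℕ} {K S : Set (Rn1 n)} (hK : IsClosed K) (hS : IsClosed S)
    (hd : Disjoint S K) :
    ∃ χ : Rn1 n → ℝ, ContDiff ℝ 1 χ ∧ (∀ z, χ z ∈ Icc (0:ℝ) 1) ∧ Disjoint (tsupport χ) S ∧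
      Disjoint (tsupport (fun z => 1 - χ z)) K := by
  obtain ⟨f, h0, h1, hf⟩ := exists_contMDiffMap_zero_one_nhds_of_isClosed
    (n := 1) (modelWithCornersSelf ℝ (Rn1 n)) hS hK hd
  refine ⟨f, f.contMDiff.contDiff, hf, ?_, ?_⟩
  · rw [disjoint_right]
    intro z hz hz'
    rw [eventually_nhdsSet_iff_forall] at h0
    exact notMem_tsupport_iff_eventuallyEq.2 (h0 z hz) hz'
  · rw [disjoint_right]
    intro z hz hz'
    rw [eventually_nhdsSet_iff_forall] at h1
    refine notMem_tsupport_iff_eventuallyEq.2 ?_ hz'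
    filter_upwards [h1 z hz] with y hy
    simp [hy]

theorem DD_split {n : ℕ} {η : Rn1 n → Rn1 n} (E : Set (Rn1 n)) (h : ContDiff ℝ 1 η)
    (hc : HasCompactSupport η) {χ : Rn1 n → ℝ} (hχ : ContDiff ℝ 1 χ) :
    DD E η = DD E (fun z => χ z • η z) + DD E (fun z => (1 - χ z) • η z) := by
  have c1 : ContDiff ℝ 1 (fun z => χ z • η z) := hχ.smul h
  have c2 : ContDiff ℝ 1 (fun z => (1 - χ z) • η z) := (contDiff_const.sub hχ).smul h
  have d1 : HasCompactSupport (fun z => χ z • η z) := hc.smul_left (f := χ)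
  have d2 : HasCompactSupport (fun z => (1 - χ z) • η z) := hc.smul_left (f := fun z => 1 - χ z)
  rw [← DD_add E c1 c2 d1 d2]
  congr 1
  funext z
  module

theorem localize {n : ℕ} {Φ : Rn1 n → ℝ} (hΦ : IsNorm1 Φ) {E F K A W : Set (Rn1 n)}
    (hK : IsCompact K) (hKA : K ⊆ A) (hA : IsOpen A) (hAW : A ⊆ W)
    (hEF : E \ K = F \ K) (hbE : BddAbove (perSet1 Φ E W)) (hbF : BddAbove (perSet1 Φ F A))
    (hcmp : ∀ η, Test1 W Φ η → ∀ ε > 0, ∃ ζ, Test1 W Φ ζ ∧ DD E η ≤ DD F ζ + ε) :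
    Per1 Φ E A ≤ Per1 Φ F A := by
  have hag : ∀ B, ∀ η, Test1 (B \ K) Φ η → DD E η = DD F η := fun B η h =>
    DD_congr hK.measurableSet hEF h.1 h.2.1 (disjoint_left.2 fun z hz hz' => (h.2.2.1 hz).2 hz')
  refine csSup_le ⟨_, _, Test1.zero hΦ A, rfl⟩ ?_
  rintro r ⟨η, hη, rfl⟩
  change DD E η ≤ _
  refine le_of_forall_pos_le_add fun ε hε => ?_
  have hε3 : 0 < ε / 3 := by positivity
  obtain ⟨θ, hθ, hθ'⟩ := near_opt (A := W \ K) hΦ (hbE.mono (perSet1_mono sdiff_subset)) hε3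
  obtain ⟨θ₂, hθ₂, hθ₂'⟩ := near_opt (A := A \ K) hΦ (hbF.mono (perSet1_mono sdiff_subset)) hε3
  have hSc : IsClosed (tsupport θ ∪ tsupport θ₂ ∪ Aᶜ) :=
    ((isClosed_tsupport _).union (isClosed_tsupport _)).union hA.isClosed_compl
  have hSd : Disjoint (tsupport θ ∪ tsupport θ₂ ∪ Aᶜ) K := by
    rw [disjoint_right]
    rintro z hz ((h | h) | h)
    · exact (hθ.2.2.1 h).2 hz
    · exact (hθ₂.2.2.1 h).2 hz
    · exact h (hKA hz)
  obtain ⟨χ, hχ, h01, hχS, hχK⟩ := exists_cut hK.isClosed hSc hSd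
  have hχA : tsupport χ ⊆ A := fun z hz => by
    by_contra h
    exact disjoint_left.1 hχS hz (Or.inr h)
  have hχ' : ContDiff ℝ 1 fun z => 1 - χ z := contDiff_const.sub hχ
  have h01' : ∀ z, 1 - χ z ∈ Icc (0:ℝ) 1 := fun z =>
    ⟨by linarith [(h01 z).2], by linarith [(h01 z).1]⟩
  have hout : ∀ B η, Test1 B Φ η → Test1 (B \ K) Φ (fun z => (1 - χ z) • η z) := fun B η h =>
    h.cut hΦ hχ' h01' fun z hz => ⟨hz.2, disjoint_left.1 hχK hz.1⟩
  have hin : ∀ B η, Test1 B Φ η → Test1 A Φ (fun z => χ z • η z) := fun B η h =>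
    h.cut hΦ hχ h01 fun z hz => hχA hz.1
  have hts : ∀ η : Rn1 n → Rn1 n, tsupport (fun z => χ z • η z) ⊆ tsupport χ := fun η =>
    (tsupport_smul_left χ η).trans inter_subset_left
  -- step 1
  have e1 := DD_split E hη.1 hη.2.1 hχ
  have e2 : DD E (fun z => (1 - χ z) • η z) ≤ DD F θ₂ + ε / 3 := by
    rw [hag _ _ (hout A η hη)]
    exact hθ₂' _ (hout A η hη)
  have t1 : Test1 W Φ (fun z => χ z • η z + θ z) :=
    ((hin A η hη).mono hAW).add (hθ.mono sdiff_subset) (disjoint_left.2 fun z hz hz' =>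
      disjoint_left.1 hχS (hts η hz) (Or.inl (Or.inl hz')))
  obtain ⟨ζ, hζ, hle⟩ := hcmp _ t1 (ε / 3) hε3
  rw [DD_add E (hin A η hη).1 hθ.1 (hin A η hη).2.1 hθ.2.1] at hle
  have e3 := DD_split F hζ.1 hζ.2.1 hχ
  have e4 : DD F (fun z => (1 - χ z) • ζ z) ≤ DD E θ + ε / 3 := by
    rw [← hag _ _ (hout W ζ hζ)]
    exact hθ' _ (hout W ζ hζ)
  have t2 : Test1 A Φ (fun z => χ z • ζ z + θ₂ z) :=
    (hin W ζ hζ).add (hθ₂.mono sdiff_subset) (disjoint_left.2 fun z hz hz' =>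
      disjoint_left.1 hχS (hts ζ hz) (Or.inl (Or.inr hz')))
  have e5 : DD F (fun z => χ z • ζ z + θ₂ z) ≤ Per1 Φ F A := le_csSup hbF ⟨_, t2, rfl⟩
  rw [DD_add F (hin W ζ hζ).1 hθ₂.1 (hin W ζ hζ).2.1 hθ₂.2.1] at e5
  linarith

open MeasureTheory Set Filter
open scoped Topology

theorem clm_eq_sum {n : ℕ} (L : Rn n →L[ℝ] ℝ) (x : Rn n) :
    L x = ∑ i, L (EuclideanSpace.single i (1:ℝ)) * x i := by
  conv_lhs => rw [← (EuclideanSpace.basisFun (Fin n) ℝ).sum_repr x]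
  simp [mul_comm]

theorem fderiv_coord {n : ℕ} {ξ : Rn n → Rn n} (hξ : ContDiff ℝ 1 ξ) (x v : Rn n) (i : Fin n) :
    fderiv ℝ (fun y => ξ y i) x v = (fderiv ℝ ξ x v) i := by
  have h1 := (hξ.differentiable one_ne_zero x).hasFDerivAt
  have := ((EuclideanSpace.proj (𝕜 := ℝ) i).hasFDerivAt (x := ξ x)).comp x h1
  have h2 : HasFDerivAt (fun y => ξ y i) ((EuclideanSpace.proj (𝕜 := ℝ) i).comp (fderiv ℝ ξ x)) x :=
    this
  rw [h2.fderiv]; rfl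

theorem ibp {n : ℕ} {h : Rn n → ℝ} (hh : ContDiff ℝ 1 h) {ξ : Rn n → Rn n}
    (hξ : ContDiff ℝ 1 ξ) (hc : HasCompactSupport ξ) :
    ∫ x, h x * divN ξ x = - ∫ x, fderiv ℝ h x (ξ x) := by
  have hco : ∀ i, ContDiff ℝ 1 (fun y => ξ y i) := fun i =>
    (EuclideanSpace.proj (𝕜 := ℝ) i).contDiff.comp hξ
  have hcs : ∀ i, HasCompactSupport (fun y => ξ y i) := fun i => by
    refine HasCompactSupport.intro hc fun x hx => ?_
    simp [image_eq_zero_of_notMem_tsupport hx]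
  have hd := hh.continuous_fderiv one_ne_zero
  have hcont := hh.continuous
  have i1 : ∀ i, Integrable fun x => fderiv ℝ h x (EuclideanSpace.single i (1:ℝ)) * ξ x i :=
    fun i => by
      refine Continuous.integrable_of_hasCompactSupport ?_ ((hcs i).mul_left)
      have := (hco i).continuous
      fun_prop
  have i2 : ∀ i, Integrable fun x => h x * fderiv ℝ (fun y => ξ y i) x
      (EuclideanSpace.single i (1:ℝ)) := fun i => by
      have h1 := (hco i).continuous_fderiv one_ne_zero
      refine Continuous.integrable_of_hasCompactSupport (by fun_prop) ?_
      exact (HasCompactSupport.intro (hcs i) fun x hx => by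
        simp [fderiv_of_notMem_tsupport ℝ hx])
  have i3 : ∀ i, Integrable fun x => h x * ξ x i := fun i =>
    Continuous.integrable_of_hasCompactSupport (hcont.mul (hco i).continuous) ((hcs i).mul_left)
  have key : ∀ i, ∫ x, h x * fderiv ℝ (fun y => ξ y i) x (EuclideanSpace.single i (1:ℝ)) =
      - ∫ x, fderiv ℝ h x (EuclideanSpace.single i (1:ℝ)) * ξ x i := fun i =>
    integral_mul_fderiv_eq_neg_fderiv_mul_of_integrable (i1 i) (i2 i) (i3 i)
      (fun x _ => hh.differentiable one_ne_zero x) (fun x _ => (hco i).differentiable one_ne_zero x)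
  simp_rw [clm_eq_sum (fderiv ℝ h _) (ξ _)]
  rw [integral_finsetSum _ fun i _ => i1 i, ← Finset.sum_neg_distrib]
  simp_rw [← key]
  rw [← integral_finsetSum _ fun i _ => i2 i]
  congr 1
  funext x
  simp_rw [fderiv_coord hξ, divN, Finset.mul_sum]

theorem integral_divN {n : ℕ} {ξ : Rn n → Rn n}
    (hξ : ContDiff ℝ 1 ξ) (hc : HasCompactSupport ξ) : ∫ x, divN ξ x = 0 := by
  have := ibp (h := fun _ => (1:ℝ)) contDiff_const hξ hc
  simpa using this

theorem integral_subgraph {n : ℕ} {h : Rn n → ℝ} (hh : Measurable h) {g : Rn1 n → ℝ}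
    (hg : Integrable g) :
    ∫ z in {z : Rn1 n | z.2 < h z.1}, g z = ∫ x, ∫ t in Iio (h x), g (x, t) := by
  have hm : MeasurableSet {z : Rn1 n | z.2 < h z.1} :=
    measurableSet_lt measurable_snd (hh.comp measurable_fst)
  rw [← integral_indicator hm, Measure.volume_eq_prod, integral_prod]
  · congr 1
    funext x
    rw [← integral_indicator measurableSet_Iio]
    rfl
  · rw [← Measure.volume_eq_prod]
    exact hg.indicator hm

theorem integral_Iio_shift (f : ℝ → ℝ) (c : ℝ) :
    ∫ t in Iio c, f t = ∫ s in Iio 0, f (s + c) := by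
  rw [← integral_indicator measurableSet_Iio, ← integral_indicator measurableSet_Iio,
    ← integral_add_right_eq_self _ c]
  congr 1
  funext s
  simp [indicator]

theorem smooth_graph {n : ℕ} {h : Rn n → ℝ} (hh : ContDiff ℝ 1 h) {η : Rn1 n → Rn1 n}
    (hη : ContDiff ℝ 1 η) (hc : HasCompactSupport η) :
    DD {z : Rn1 n | z.2 < h z.1} η =
      ∫ x, (h x * divN (fun y => (- η (y, h y)).1) x + (- η (x, h x)).2) := by
  have hcont := hh.continuous
  have hηc := hη.continuous
  have hdη := hη.continuous_fderiv one_ne_zero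
  have hdh := hh.continuous_fderiv one_ne_zero
  let Λ : Rn1 n ≃ₜ Rn1 n :=
    { toFun := fun z => (z.1, z.2 + h z.1)
      invFun := fun z => (z.1, z.2 - h z.1)
      left_inv := fun z => by simp
      right_inv := fun z => by simp
      continuous_toFun := by fun_prop
      continuous_invFun := by fun_prop }
  have hΛ : ∀ z, Λ z = (z.1, z.2 + h z.1) := fun z => rfl
  -- compact supports in x
  have hK : IsCompact (Prod.fst '' tsupport η) := hc.image continuous_fst
  have hcx : ∀ s, HasCompactSupport (fun y => η (y, s + h y)) := fun s => by
    refine HasCompactSupport.intro hK fun x hx => ?_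
    exact image_eq_zero_of_notMem_tsupport fun h' => hx ⟨_, h', rfl⟩
  have hC : ∀ s, ContDiff ℝ 1 (fun y => η (y, s + h y)) := fun s =>
    hη.comp (contDiff_id.prodMk (contDiff_const.add hh))
  have hcx1 : ∀ s, HasCompactSupport (fun y => (η (y, s + h y)).1) := fun s =>
    (hcx s).comp_left (g := Prod.fst) rfl
  have hC1 : ∀ s, ContDiff ℝ 1 (fun y => (η (y, s + h y)).1) := fun s => (hC s).fst
  -- decomposition
  let b : Rn1 n → ℝ := fun z => (fderiv ℝ η (Λ z) ((0 : Rn n), (1:ℝ))).2 -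
    fderiv ℝ h z.1 (fderiv ℝ η (Λ z) ((0 : Rn n), (1:ℝ))).1
  have hbc : Continuous b := by
    have := Λ.continuous
    simp only [b]; fun_prop
  have hΛc : IsCompact (Λ ⁻¹' tsupport η) := Λ.isCompact_preimage.2 hc
  have hbs : HasCompactSupport b := by
    refine HasCompactSupport.intro hΛc fun z hz => ?_
    simp [b, fderiv_of_notMem_tsupport ℝ (show Λ z ∉ tsupport η from hz)]
  have hgc : Continuous fun z => div1 η (Λ z) := (div1_continuous hη).comp Λ.continuous
  have hgs : HasCompactSupport fun z => div1 η (Λ z) := by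
    refine HasCompactSupport.intro hΛc fun z hz => ?_
    exact div1_zero_of_notMem hz
  have hdec : ∀ x s, div1 η (x, s + h x) = divN (fun y => (η (y, s + h y)).1) x + b (x, s) := by
    intro x s
    have h1 : HasFDerivAt (fun y => (y, s + h y))
        ((ContinuousLinearMap.id ℝ (Rn n)).prod (fderiv ℝ h x)) x :=
      (hasFDerivAt_id x).prodMk ((hh.differentiable one_ne_zero x).hasFDerivAt.const_add s)
    have h2 := (hη.differentiable one_ne_zero (x, s + h x)).hasFDerivAt
    have h3 : HasFDerivAt (fun y => (η (y, s + h y)).1) _ x := (h2.comp x h1).fst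
    have h4 : ∀ v : Rn n, fderiv ℝ η (x, s + h x) (v, fderiv ℝ h x v) =
        fderiv ℝ η (x, s + h x) (v, 0) + fderiv ℝ h x v • fderiv ℝ η (x, s + h x) (0, 1) := by
      intro v
      rw [← map_smul, ← map_add]
      simp
    have h5 := clm_eq_sum (fderiv ℝ h x) (fderiv ℝ η (x, s + h x) ((0 : Rn n), (1:ℝ))).1
    have h6 : ∀ v : Rn n, fderiv ℝ (fun y => (η (y, s + h y)).1) x v =
        (fderiv ℝ η (x, s + h x) (v, fderiv ℝ h x v)).1 := fun v => by
      rw [h3.fderiv]; rfl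
    simp only [div1, divN, b, hΛ, h5, h6, h4, Prod.fst_add, Prod.smul_fst, PiLp.add_apply,
      PiLp.smul_apply, smul_eq_mul, Finset.sum_add_distrib]
    ring
  have hbint : Integrable b := hbc.integrable_of_hasCompactSupport hbs
  have hgint : Integrable fun z => div1 η (Λ z) := hgc.integrable_of_hasCompactSupport hgs
  have haint : Integrable fun z : Rn1 n => divN (fun y => (η (y, z.2 + h y)).1) z.1 := by
    refine (hgint.sub hbint).congr (Eventually.of_forall fun z => ?_)
    have := hdec z.1 z.2
    simp only [Pi.sub_apply, hΛ]
    linarith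
  have hhalf : ∀ g : Rn1 n → ℝ, Integrable g →
      Integrable g ((volume : Measure (Rn n)).prod (volume.restrict (Iio (0:ℝ)))) := fun g hg => by
    have : Integrable g (volume.restrict (univ ×ˢ Iio (0:ℝ))) := hg.integrableOn
    rwa [Measure.volume_eq_prod, ← Measure.prod_restrict, Measure.restrict_univ] at this
  have hb0 : ∀ x, ∫ s in Iio (0:ℝ), b (x, s) = (η (x, h x)).2 - fderiv ℝ h x (η (x, h x)).1 := by
    intro x
    rw [← integral_Iic_eq_integral_Iio]
    have hder : ∀ s, HasDerivAt (fun s => (η (x, s + h x)).2 - fderiv ℝ h x (η (x, s + h x)).1)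
        (b (x, s)) s := by
      intro s
      have h1 : HasDerivAt (fun s : ℝ => (x, s + h x)) ((0 : Rn n), (1:ℝ)) s :=
        (hasDerivAt_const s x).prodMk ((hasDerivAt_id s).add_const _)
      have h2 := ((hη.differentiable one_ne_zero (x, s + h x)).hasFDerivAt).comp_hasDerivAt s h1
      have h3 := (ContinuousLinearMap.fst ℝ (Rn n) ℝ).hasFDerivAt.comp_hasDerivAt s h2
      have h4 := (ContinuousLinearMap.snd ℝ (Rn n) ℝ).hasFDerivAt.comp_hasDerivAt s h2
      exact HasDerivAt.sub h4 ((fderiv ℝ h x).hasFDerivAt.comp_hasDerivAt s h3)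
    have hcs : HasCompactSupport fun s => (η (x, s + h x)).2 - fderiv ℝ h x (η (x, s + h x)).1 := by
      refine HasCompactSupport.intro (hΛc.image continuous_snd) fun s hs => ?_
      have : η (x, s + h x) = 0 := image_eq_zero_of_notMem_tsupport fun h' => hs ⟨(x, s), h', rfl⟩
      simp [this]
    have hbx : Integrable fun s => b (x, s) := by
      refine (hbc.comp (by fun_prop : Continuous fun s : ℝ => (x, s)))
        |>.integrable_of_hasCompactSupport ?_
      refine HasCompactSupport.intro (hbs.image continuous_snd) fun s hs => ?_
      exact image_eq_zero_of_notMem_tsupport (f := b) fun h' => hs ⟨(x, s), h', rfl⟩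
    have h0 := hcs.is_zero_at_infty
    have := integral_Iic_of_hasDerivAt_of_tendsto' (a := 0) (fun s _ => hder s) hbx.integrableOn
      (h0.mono_left atBot_le_cocompact)
    rw [this]; simp
  have hLint : Integrable fun x => (η (x, h x)).2 - fderiv ℝ h x (η (x, h x)).1 := by
    have hc' := (hcx 0)
    simp only [zero_add] at hc'
    refine Continuous.integrable_of_hasCompactSupport (by fun_prop) ?_
    refine HasCompactSupport.intro hc' fun x hx => ?_
    have : η (x, h x) = 0 := image_eq_zero_of_notMem_tsupport (f := fun x => η (x, h x)) hx
    simp [this]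
  have main : ∫ z in {z : Rn1 n | z.2 < h z.1}, div1 η z =
      ∫ x, ((η (x, h x)).2 - fderiv ℝ h x (η (x, h x)).1) := by
    rw [integral_subgraph hcont.measurable (div1_integrable hη hc)]
    simp_rw [integral_Iio_shift _ (h _), hdec]
    have e1 := integral_prod _ ((hhalf _ haint).add (hhalf _ hbint))
    simp only [Pi.add_apply] at e1
    rw [← e1, integral_add (hhalf _ haint) (hhalf _ hbint), integral_prod_symm _ (hhalf _ haint),
      integral_prod _ (hhalf _ hbint)]
    simp only [hb0]
    rw [integral_congr_ae (g := fun _ => (0:ℝ)), integral_zero, zero_add]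
    exact Eventually.of_forall fun s => integral_divN (hC1 s) (hcx1 s)
  unfold DD
  rw [main]
  have c1 : ContDiff ℝ 1 (fun y => (- η (y, h y)).1) := by simpa using (hC1 0).neg
  have hcx0 : HasCompactSupport (fun y => η (y, h y)) := by simpa using hcx 0
  have s1 : HasCompactSupport (fun y => (- η (y, h y)).1) :=
    hcx0.comp_left (g := fun p : Rn1 n => (-p).1) (by simp)
  have hz := ibp hh (ξ := fun y => (- η (y, h y)).1) c1 s1
  have hi1 : Integrable fun x => h x * divN (fun y => (- η (y, h y)).1) x := by
    exact (hcont.mul (divN_continuous c1)).integrable_of_hasCompactSupport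
      (divN_hasCompactSupport s1).mul_left
  have hi2 : Integrable fun x => (η (x, h x)).2 := by
    refine Continuous.integrable_of_hasCompactSupport (by fun_prop) ?_
    exact hcx0.comp_left (g := Prod.snd) rfl
  have hi3 : Integrable fun x => fderiv ℝ h x (η (x, h x)).1 := by
    have := hi2.sub hLint
    refine this.congr (Eventually.of_forall fun x => ?_)
    simp
  rw [integral_add hi1 (by simpa using hi2.neg), hz, integral_sub hi2 hi3]
  simp only [Prod.fst_neg, Prod.snd_neg, map_neg, integral_neg]
  ring

open MeasureTheory Set Filter
open scoped Topology Convolution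

theorem sg_reduce {n : ℕ} {Ω U : Set (Rn n)} (hU : IsOpen U) (hUΩ : U ⊆ Ω) {u u₀ : Rn n → ℝ}
    (hu : ∀ᵐ x, x ∈ U → u x = u₀ x) {g : Rn1 n → ℝ} (hg : Integrable g)
    (h0 : ∀ z : Rn1 n, z.1 ∉ U → g z = 0) :
    ∫ z in sg Ω u, g z = ∫ z in {z : Rn1 n | z.2 < u₀ z.1}, g z := by
  have hW : MeasurableSet (U ×ˢ (univ : Set ℝ)) := hU.measurableSet.prod MeasurableSet.univ
  have key : ∀ S : Set (Rn1 n), ∫ z in S, g z = ∫ z in S ∩ U ×ˢ (univ : Set ℝ), g z := by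
    intro S
    rw [← integral_inter_add_sdiff hW hg.integrableOn,
      setIntegral_eq_zero_of_forall_eq_zero (t := S \ _), add_zero]
    intro z hz
    exact h0 z fun h => hz.2 ⟨h, mem_univ _⟩
  rw [key (sg Ω u), key {z : Rn1 n | z.2 < u₀ z.1}]
  apply setIntegral_congr_set
  have hq : ∀ᵐ z : Rn1 n, z.1 ∈ U → u z.1 = u₀ z.1 := by
    rw [Measure.volume_eq_prod]
    exact Measure.quasiMeasurePreserving_fst.ae hu
  filter_upwards [hq] with z hz
  apply propext
  constructor
  · rintro ⟨h1, h2⟩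
    refine ⟨?_, h2⟩
    have : z.2 < u z.1 := h1.2
    rw [hz h2.1] at this; exact this
  · rintro ⟨h1, h2⟩
    refine ⟨⟨hUΩ h2.1, ?_⟩, h2⟩
    rw [hz h2.1]; exact h1

theorem exists_rep {n : ℕ} {U : Set (Rn n)} (hU : IsOpen U) {u : Rn n → ℝ}
    (hu : IntegrableOn u U) :
    ∃ u₀ : Rn n → ℝ, Measurable u₀ ∧ Integrable u₀ ∧ ∀ᵐ x, x ∈ U → u x = u₀ x := by
  have hi : Integrable (U.indicator u) := (integrable_indicator_iff hU.measurableSet).2 hu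
  refine ⟨hi.1.mk _, hi.1.stronglyMeasurable_mk.measurable, hi.congr hi.1.ae_eq_mk, ?_⟩
  filter_upwards [hi.1.ae_eq_mk] with x hx hxU
  rw [← hx, indicator_of_mem hxU]

theorem graph_null {n : ℕ} {u₀ : Rn n → ℝ} (hm : Measurable u₀) :
    ∀ᵐ z : Rn1 n, z.2 ≠ u₀ z.1 := by
  have : MeasurableSet {z : Rn1 n | z.2 = u₀ z.1} :=
    measurableSet_eq_fun measurable_snd (hm.comp measurable_fst)
  rw [ae_iff]
  simp only [ne_eq, not_not]
  rw [Measure.volume_eq_prod, Measure.measure_prod_null this]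
  refine Eventually.of_forall fun x => ?_
  have : (Prod.mk x ⁻¹' {z : Rn1 n | z.2 = u₀ z.1}) = {u₀ x} := by
    ext t; simp
  simp [this]

theorem DD_tendsto {n : ℕ} {u₀ : Rn n → ℝ} (hm : Measurable u₀) {v : ℕ → Rn n → ℝ}
    (hv : ∀ k, Measurable (v k)) (hlim : ∀ᵐ x, Tendsto (fun k => v k x) atTop (𝓝 (u₀ x)))
    {η : Rn1 n → Rn1 n} (hη : ContDiff ℝ 1 η) (hc : HasCompactSupport η) :
    Tendsto (fun k => DD {z : Rn1 n | z.2 < v k z.1} η) atTop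
      (𝓝 (DD {z : Rn1 n | z.2 < u₀ z.1} η)) := by
  unfold DD
  have hms : ∀ w : Rn n → ℝ, Measurable w → MeasurableSet {z : Rn1 n | z.2 < w z.1} :=
    fun w hw => measurableSet_lt measurable_snd (hw.comp measurable_fst)
  simp_rw [← integral_indicator (hms _ hm), fun k => (integral_indicator (μ := volume)
    (f := div1 η) (hms _ (hv k))).symm]
  refine Tendsto.neg ?_
  have hi := div1_integrable hη hc
  refine tendsto_integral_of_dominated_convergence (fun z => ‖div1 η z‖)
    (fun k => (hi.indicator (hms _ (hv k))).1) hi.norm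
    (fun k => Eventually.of_forall fun z => norm_indicator_le_norm_self _ _) ?_
  have hq : ∀ᵐ z : Rn1 n, Tendsto (fun k => v k z.1) atTop (𝓝 (u₀ z.1)) := by
    rw [Measure.volume_eq_prod]
    exact Measure.quasiMeasurePreserving_fst.ae hlim
  filter_upwards [hq, graph_null hm] with z h1 h2
  refine tendsto_const_nhds.congr' ?_
  rcases lt_or_gt_of_ne h2 with h | h
  · filter_upwards [h1.eventually_const_lt h] with k hk
    rw [indicator_of_mem (by exact h), indicator_of_mem (by exact hk)]
  · filter_upwards [h1.eventually_lt_const h] with k hk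
    rw [indicator_of_notMem (by simpa using h.le), indicator_of_notMem (by simpa using hk.le)]

theorem mollify_le {n : ℕ} (φ : ContDiffBump (0 : Rn n)) {u₀ f g : Rn n → ℝ} (hu : Integrable u₀)
    (hf : Continuous f) (hfc : HasCompactSupport f) (hg : Continuous g) (hgc : HasCompactSupport g)
    {M : ℝ} (hM : ∀ y ∈ Metric.ball (0 : Rn n) φ.rOut, ∫ x, (u₀ x * f (x + y) + g (x + y)) ≤ M) :
    ∫ x, ((φ.normed volume ⋆[ContinuousLinearMap.lsmul ℝ ℝ, volume] u₀) x * f x + g x) ≤ M := by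
  set ψ : Rn n → ℝ := φ.normed volume with hψ
  have hψi : Integrable ψ := φ.integrable_normed
  have hψ1 : ∫ y, ψ y = 1 := φ.integral_normed
  obtain ⟨C, hC⟩ := hfc.exists_bound_of_continuous hf
  have h1 : Integrable (fun p : Rn n × Rn n => ψ p.2 * u₀ (p.1 - p.2)) (volume.prod volume) :=
    Integrable.convolution_integrand (ContinuousLinearMap.lsmul ℝ ℝ) hψi hu
  have h2 : Integrable (fun p : Rn n × Rn n => (ψ p.2 * u₀ (p.1 - p.2)) * f p.1)
      (volume.prod volume) :=
    h1.mul_bdd (c := C) (hf.comp continuous_fst).aestronglyMeasurable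
      (Eventually.of_forall fun p => hC p.1)
  have hgi : Integrable g := hg.integrable_of_hasCompactSupport hgc
  have h3 : Integrable (fun p : Rn n × Rn n => g p.1 * ψ p.2) (volume.prod volume) :=
    hgi.mul_prod hψi
  have hH := h2.add h3
  have e1 : ∀ x, ∫ y, ((fun p : Rn n × Rn n => (ψ p.2 * u₀ (p.1 - p.2)) * f p.1) +
      (fun p : Rn n × Rn n => g p.1 * ψ p.2)) (x, y) =
      (ψ ⋆[ContinuousLinearMap.lsmul ℝ ℝ, volume] u₀) x * f x + g x := by
    intro x
    have hex : Integrable fun y => ψ y * u₀ (x - y) :=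
      (φ.hasCompactSupport_normed.convolutionExists_left (ContinuousLinearMap.lsmul ℝ ℝ)
        φ.continuous_normed hu.locallyIntegrable) x
    simp only [Pi.add_apply]
    rw [integral_add (hex.mul_const _) (hψi.const_mul _), integral_mul_const, integral_const_mul,
      hψ1, mul_one]
    rfl
  have e2 : ∀ y, ∫ x, ((fun p : Rn n × Rn n => (ψ p.2 * u₀ (p.1 - p.2)) * f p.1) +
      (fun p : Rn n × Rn n => g p.1 * ψ p.2)) (x, y) =
      ψ y * ∫ x, (u₀ x * f (x + y) + g (x + y)) := by
    intro y
    rw [← integral_const_mul, ← integral_add_right_eq_self _ y]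
    congr 1
    funext x
    simp only [Pi.add_apply, add_sub_cancel_right]
    ring
  simp_rw [← e1]
  rw [integral_integral_swap hH]
  have hint := hH.integral_prod_right
  simp_rw [e2] at hint ⊢
  calc ∫ y, ψ y * ∫ x, (u₀ x * f (x + y) + g (x + y)) ≤ ∫ y, ψ y * M := by
        refine integral_mono hint (hψi.mul_const M) fun y => ?_
        by_cases hy : y ∈ Metric.ball (0 : Rn n) φ.rOut
        · exact mul_le_mul_of_nonneg_left (hM y hy) (φ.nonneg_normed y)
        · have : ψ y = 0 := by
            rw [← φ.support_normed_eq (μ := volume)] at hy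
            simpa using hy
          simp [this]
    _ = M := by rw [integral_mul_const, hψ1, one_mul]

theorem divN_translate {n : ℕ} (ξ : Rn n → Rn n) (x y : Rn n) :
    divN (fun x => ξ (x + y)) x = divN ξ (x + y) := by
  simp [divN, fderiv_comp_add_right]

theorem lemmaA {n : ℕ} {Φ : Rn1 n → ℝ} (hΦ : IsNorm1 Φ) {Ω U : Set (Rn n)} (hU : IsOpen U)
    (hUΩ : U ⊆ Ω) {u : Rn n → ℝ} (hu : IntegrableOn u U) {M : ℝ} (hM : M ∈ upperBounds (Gset Φ U u))
    {η : Rn1 n → Rn1 n} (hη : Test1 (U ×ˢ (univ : Set ℝ)) Φ η) : DD (sg Ω u) η ≤ M := by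
  obtain ⟨u₀, hm, hi, hae⟩ := exists_rep hU hu
  obtain ⟨hη1, hηc, hηs, hηΦ⟩ := hη
  have e0 : DD (sg Ω u) η = DD {z : Rn1 n | z.2 < u₀ z.1} η := by
    unfold DD
    rw [sg_reduce hU hUΩ hae (div1_integrable hη1 hηc)]
    intro z hz
    exact div1_zero_of_notMem fun h => hz (hηs h).1
  rw [e0]
  have hK : IsCompact (Prod.fst '' tsupport η) := hηc.image continuous_fst
  have hKU : Prod.fst '' tsupport η ⊆ U := by
    rintro _ ⟨z, hz, rfl⟩
    exact (hηs hz).1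
  obtain ⟨δ, hδ, hδU⟩ := hK.exists_cthickening_subset_open hU hKU
  let φ : ℕ → ContDiffBump (0 : Rn n) := fun k =>
    ⟨1 / ((k : ℝ) + 1), 2 * (1 / ((k : ℝ) + 1)), by positivity, by
      have : 0 < 1 / ((k : ℝ) + 1) := by positivity
      linarith⟩
  have hφlim : Tendsto (fun k => (φ k).rOut) atTop (𝓝 0) := by
    have := (tendsto_one_div_add_atTop_nhds_zero_nat (𝕜 := ℝ)).const_mul 2
    rw [mul_zero] at this
    exact this
  let v : ℕ → Rn n → ℝ := fun k =>
    (φ k).normed volume ⋆[ContinuousLinearMap.lsmul ℝ ℝ, volume] u₀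
  have hvC : ∀ k, ContDiff ℝ 1 (v k) := fun k =>
    (φ k).hasCompactSupport_normed.contDiff_convolution_left (n := 1) _ (φ k).contDiff_normed
      hi.locallyIntegrable
  have hlim : ∀ᵐ x, Tendsto (fun k => v k x) atTop (𝓝 (u₀ x)) :=
    ContDiffBump.ae_convolution_tendsto_right_of_locallyIntegrable hφlim (K := 2)
      (Eventually.of_forall fun k => le_rfl) hi.locallyIntegrable
  refine le_of_tendsto (DD_tendsto hm (fun k => (hvC k).continuous.measurable) hlim hη1 hηc) ?_
  filter_upwards [hφlim.eventually_lt_const hδ] with k hk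
  rw [smooth_graph (hvC k) hη1 hηc]
  set ζ : Rn n → Rn1 n := fun x => - η (x, v k x) with hζ
  have hζC : ContDiff ℝ 1 ζ := (hη1.comp (contDiff_id.prodMk (hvC k))).neg
  have hζ0 : ∀ x, x ∉ Prod.fst '' tsupport η → ζ x = 0 := fun x hx => by
    have : η (x, v k x) = 0 := image_eq_zero_of_notMem_tsupport fun h' => hx ⟨_, h', rfl⟩
    simp [hζ, this]
  have hζc : HasCompactSupport ζ := HasCompactSupport.intro hK hζ0
  have hζ1 : ContDiff ℝ 1 fun y => (ζ y).1 := hζC.fst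
  have hζ1c : HasCompactSupport fun y => (ζ y).1 := hζc.comp_left (g := Prod.fst) rfl
  have hζ2c : HasCompactSupport fun y => (ζ y).2 := hζc.comp_left (g := Prod.snd) rfl
  refine mollify_le (φ k) hi (divN_continuous hζ1) (divN_hasCompactSupport hζ1c)
    (hζC.continuous.snd) hζ2c fun y hy => ?_
  refine hM ⟨fun x => ζ (x + y), hζC.comp (contDiff_id.add contDiff_const), ?_, ?_, ?_, ?_⟩
  · exact hζc.comp_homeomorph (Homeomorph.addRight y)
  · have hcl : IsClosed {x : Rn n | x + y ∈ Prod.fst '' tsupport η} :=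
      hK.isClosed.preimage (continuous_id.add continuous_const)
    refine Subset.trans (b := {x : Rn n | x + y ∈ Prod.fst '' tsupport η})
      (closure_minimal (fun x hx => ?_) hcl) (fun x hx => ?_)
    · by_contra h
      exact hx (hζ0 _ h)
    · apply hδU
      refine Metric.mem_cthickening_of_dist_le x (x + y) δ _ hx ?_
      have : dist x (x + y) = ‖y‖ := by simp [dist_eq_norm]
      rw [this]
      exact ((mem_ball_zero_iff.1 hy).trans hk).le
  · intro x
    have := hΦ.2.1 (-1) (η (x + y, v k (x + y)))
    simp only [neg_smul, one_smul, abs_neg, abs_one, one_mul] at this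
    change Φ (-η (x + y, v k (x + y))) ≤ 1
    rw [this]
    exact hηΦ _
  · have hz : ∀ x, x ∉ U → ζ (x + y) = 0 ∧ divN (fun y => (ζ y).1) (x + y) = 0 := by
      intro x hx
      have : x + y ∉ Prod.fst '' tsupport η := by
        intro h
        apply hx
        apply hδU
        refine Metric.mem_cthickening_of_dist_le x (x + y) δ _ h ?_
        have : dist x (x + y) = ‖y‖ := by simp [dist_eq_norm]
        rw [this]
        exact ((mem_ball_zero_iff.1 hy).trans hk).le
      refine ⟨hζ0 _ this, divN_zero_of_notMem fun h => this ?_⟩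
      refine closure_minimal (fun x hx => ?_) hK.isClosed h
      by_contra h'
      exact hx (by simp [hζ0 _ h'])
    rw [← setIntegral_eq_integral_of_forall_compl_eq_zero (s := U)]
    · refine setIntegral_congr_ae hU.measurableSet ?_
      filter_upwards [hae] with x hx hxU
      rw [hx hxU, divN_translate (fun y => (ζ y).1)]
    · intro x hx
      simp [hz x hx]

open MeasureTheory Set Filter
open scoped Topology

theorem exists_cutoffs : ∃ c : ℕ → ℝ → ℝ, ∀ k, ContDiff ℝ 1 (c k) ∧ HasCompactSupport (c k) ∧
    (∀ t, c k t ∈ Icc (0:ℝ) 1) ∧ ∀ t, |t| ≤ (k : ℝ) + 1 → c k t = 1 := by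
  refine ⟨fun k => (⟨(k : ℝ) + 1, (k : ℝ) + 2, by positivity, by linarith⟩ : ContDiffBump (0:ℝ)),
    fun k => ⟨ContDiffBump.contDiff _, ContDiffBump.hasCompactSupport _, fun t =>
      ⟨ContDiffBump.nonneg _, ContDiffBump.le_one _⟩, fun t ht => ?_⟩⟩
  apply ContDiffBump.one_of_mem_closedBall
  simpa using ht

/-- Product field. -/
def pf {n : ℕ} (c : ℝ → ℝ) (ζ : Rn n → Rn1 n) : Rn1 n → Rn1 n := fun z => (- c z.2) • ζ z.1

theorem pf_contDiff {n : ℕ} {c : ℝ → ℝ} {ζ : Rn n → Rn1 n} (hc : ContDiff ℝ 1 c)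
    (hζ : ContDiff ℝ 1 ζ) : ContDiff ℝ 1 (pf c ζ) :=
  (hc.comp contDiff_snd).neg.smul (hζ.comp contDiff_fst)

theorem pf_tsupport {n : ℕ} (c : ℝ → ℝ) (ζ : Rn n → Rn1 n) :
    tsupport (pf c ζ) ⊆ tsupport ζ ×ˢ tsupport c := by
  refine closure_minimal (fun z hz => ?_) ((isClosed_tsupport _).prod (isClosed_tsupport _))
  refine ⟨subset_tsupport _ fun h => hz (by simp [pf, h]), subset_tsupport _ fun h =>
    hz (by simp [pf, h])⟩

theorem pf_hasCompactSupport {n : ℕ} {c : ℝ → ℝ} {ζ : Rn n → Rn1 n} (hc : HasCompactSupport c)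
    (hζ : HasCompactSupport ζ) : HasCompactSupport (pf c ζ) :=
  IsCompact.of_isClosed_subset (IsCompact.prod hζ hc) (isClosed_tsupport _) (pf_tsupport c ζ)

theorem pf_div {n : ℕ} {c : ℝ → ℝ} {ζ : Rn n → Rn1 n} (hc : ContDiff ℝ 1 c)
    (hζ : ContDiff ℝ 1 ζ) (z : Rn1 n) :
    div1 (pf c ζ) z = - (c z.2 * divN (fun y => (ζ y).1) z.1 + deriv c z.2 * (ζ z.1).2) := by
  have h1 : HasFDerivAt (fun z : Rn1 n => - c z.2)
      (- ((fderiv ℝ c z.2).comp (ContinuousLinearMap.snd ℝ (Rn n) ℝ))) z :=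
    ((hc.differentiable one_ne_zero z.2).hasFDerivAt.comp z hasFDerivAt_snd).neg
  have h2 : HasFDerivAt (fun z : Rn1 n => ζ z.1)
      ((fderiv ℝ ζ z.1).comp (ContinuousLinearMap.fst ℝ (Rn n) ℝ)) z :=
    (hζ.differentiable one_ne_zero z.1).hasFDerivAt.comp z hasFDerivAt_fst
  have h3 : HasFDerivAt (pf c ζ) _ z := h1.smul h2
  have h4 : ∀ v, fderiv ℝ (fun y => (ζ y).1) z.1 v = (fderiv ℝ ζ z.1 v).1 := by
    intro v
    have := (hζ.differentiable one_ne_zero z.1).hasFDerivAt.fst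
    rw [this.fderiv]; rfl
  simp only [div1, h3.fderiv, divN, h4]
  simp [Finset.mul_sum]
  ring

theorem lemmaB {n : ℕ} {Ω U : Set (Rn n)} (hU : IsOpen U)
    (hUΩ : U ⊆ Ω) {u : Rn n → ℝ} (hu : IntegrableOn u U) {c : ℕ → ℝ → ℝ}
    (hc : ∀ k, ContDiff ℝ 1 (c k) ∧ HasCompactSupport (c k) ∧
    (∀ t, c k t ∈ Icc (0:ℝ) 1) ∧ ∀ t, |t| ≤ (k : ℝ) + 1 → c k t = 1) {ζ : Rn n → Rn1 n}
    (hζ : ContDiff ℝ 1 ζ) (hζc : HasCompactSupport ζ) (hζU : tsupport ζ ⊆ U) :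
    Tendsto (fun k => DD (sg Ω u) (pf (c k) ζ)) atTop
      (𝓝 (∫ x in U, (u x * divN (fun y => (ζ y).1) x + (ζ x).2))) := by
  obtain ⟨u₀, hm, hi, hae⟩ := exists_rep hU hu
  have hζ1 : ContDiff ℝ 1 fun y => (ζ y).1 := hζ.fst
  have hζ1c : HasCompactSupport fun y => (ζ y).1 := hζc.comp_left (g := Prod.fst) rfl
  have hζ2c : HasCompactSupport fun y => (ζ y).2 := hζc.comp_left (g := Prod.snd) rfl
  set f : Rn n → ℝ := divN (fun y => (ζ y).1) with hf
  set g : Rn n → ℝ := fun x => (ζ x).2 with hg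
  have hfc : Continuous f := divN_continuous hζ1
  have hgc : Continuous g := hζ.continuous.snd
  have hfi : Integrable f := divN_integrable hζ1 hζ1c
  have hgi : Integrable g := hgc.integrable_of_hasCompactSupport hζ2c
  have hsub : tsupport (fun y => (ζ y).1) ⊆ tsupport ζ :=
    closure_mono (fun y (hy : (ζ y).1 ≠ 0) (h' : ζ y = 0) => hy (by simp [h']))
  have hf0 : ∀ x, x ∉ U → f x = 0 := fun x hx => divN_zero_of_notMem fun h => hx (hζU (hsub h))
  have hg0 : ∀ x, x ∉ U → g x = 0 := fun x hx => by
    simp [hg, image_eq_zero_of_notMem_tsupport fun h => hx (hζU h)]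
  obtain ⟨C, hC⟩ := (divN_hasCompactSupport hζ1c).exists_bound_of_continuous hfc
  have elim : ∫ x in U, (u x * f x + g x) = ∫ x, (f x * u₀ x + g x) := by
    rw [← setIntegral_eq_integral_of_forall_compl_eq_zero (s := U)
      (f := fun x => f x * u₀ x + g x)]
    · refine setIntegral_congr_ae hU.measurableSet ?_
      filter_upwards [hae] with x hx hxU
      rw [hx hxU]; ring
    · intro x hx
      simp [hf0 x hx, hg0 x hx]
  rw [elim]
  have cint : ∀ k, Integrable (c k) := fun k =>
    (hc k).1.continuous.integrable_of_hasCompactSupport (hc k).2.1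
  have hJb : ∀ k s, ‖∫ t in (0:ℝ)..s, c k t‖ ≤ ‖s‖ := by
    intro k s
    have := intervalIntegral.norm_integral_le_of_norm_le_const (a := 0) (b := s) (f := c k) (C := 1)
      fun t _ => by
        rw [Real.norm_eq_abs, abs_of_nonneg ((hc k).2.2.1 t).1]; exact ((hc k).2.2.1 t).2
    simpa using this
  have hJc : ∀ k, Continuous fun s => ∫ t in (0:ℝ)..s, c k t := fun k =>
    intervalIntegral.continuous_primitive (fun a b => (cint k).intervalIntegrable) 0
  have hcb : ∀ k t, ‖c k t‖ ≤ 1 := fun k t => by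
    rw [Real.norm_eq_abs, abs_of_nonneg ((hc k).2.2.1 t).1]; exact ((hc k).2.2.1 t).2
  have hmeas : ∀ k, AEStronglyMeasurable
      (fun x => f x * (∫ t in (0:ℝ)..u₀ x, c k t) + g x * c k (u₀ x)) volume := fun k => by
    have h1 : Measurable fun x => ∫ t in (0:ℝ)..u₀ x, c k t := (hJc k).measurable.comp hm
    have h2 : Measurable fun x => c k (u₀ x) := (hc k).1.continuous.measurable.comp hm
    exact ((hfc.measurable.mul h1).add (hgc.measurable.mul h2)).aestronglyMeasurable
  have hbound : ∀ k x, ‖f x * (∫ t in (0:ℝ)..u₀ x, c k t) + g x * c k (u₀ x)‖ ≤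
      C * ‖u₀ x‖ + ‖g x‖ := by
    intro k x
    refine (norm_add_le _ _).trans (add_le_add ?_ ?_)
    · rw [norm_mul]
      exact mul_le_mul (hC x) (hJb k _) (norm_nonneg _) ((norm_nonneg _).trans (hC x))
    · rw [norm_mul]
      exact mul_le_of_le_one_right (norm_nonneg _) (hcb k _)
  have hbi : Integrable fun x => C * ‖u₀ x‖ + ‖g x‖ := (hi.norm.const_mul C).add hgi.norm
  have hform : ∀ k, DD (sg Ω u) (pf (c k) ζ) =
      ∫ x, (f x * (∫ t in (0:ℝ)..u₀ x, c k t) + g x * c k (u₀ x)) := by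
    intro k
    obtain ⟨hk1, hk2, hk3, hk4⟩ := hc k
    have hpi := div1_integrable (pf_contDiff hk1 hζ) (pf_hasCompactSupport hk2 hζc)
    unfold DD
    rw [sg_reduce hU hUΩ hae hpi, integral_subgraph hm hpi, ← integral_neg]
    · have hdi : Integrable (deriv (c k)) :=
        (hk1.continuous_deriv le_rfl).integrable_of_hasCompactSupport hk2.deriv
      have hx : ∀ x, -∫ t in Iio (u₀ x), div1 (pf (c k) ζ) (x, t) =
          (f x * (∫ t in (0:ℝ)..u₀ x, c k t) + g x * c k (u₀ x)) + (∫ t in Iic 0, c k t) * f x := by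
        intro x
        simp_rw [pf_div hk1 hζ]
        rw [integral_neg, neg_neg, integral_add ((cint k).mul_const _).integrableOn
          (hdi.mul_const _).integrableOn, integral_mul_const, integral_mul_const,
          ← integral_Iic_eq_integral_Iio, ← integral_Iic_eq_integral_Iio]
        have e1 := integral_Iic_of_hasDerivAt_of_tendsto' (a := u₀ x)
          (fun s _ => (hk1.differentiable one_ne_zero s).hasDerivAt) hdi.integrableOn
          (hk2.is_zero_at_infty.mono_left atBot_le_cocompact)
        have e2 := intervalIntegral.integral_Iic_sub_Iic (a := 0) (b := u₀ x)
          (cint k).integrableOn (cint k).integrableOn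
        rw [e1, ← e2]
        simp only [hf, hg]
        ring
      simp_rw [hx]
      rw [integral_add _ (hfi.const_mul _), integral_const_mul, integral_divN hζ1 hζ1c]
      · simp
      · exact hbi.mono' (hmeas k) (Eventually.of_forall (hbound k))
    · intro z hz
      exact div1_zero_of_notMem fun h => hz (hζU (pf_tsupport _ _ h).1)
  simp_rw [hform]
  refine tendsto_integral_of_dominated_convergence _ hmeas hbi
    (fun k => Eventually.of_forall (hbound k)) (Eventually.of_forall fun x => ?_)
  refine tendsto_const_nhds.congr' ?_
  obtain ⟨N, hN⟩ := exists_nat_ge |u₀ x|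
  filter_upwards [eventually_ge_atTop N] with k hk
  have hkN : |u₀ x| ≤ (k : ℝ) + 1 := by
    have : (N : ℝ) ≤ k := by exact_mod_cast hk
    linarith
  have e1 : ∫ t in (0:ℝ)..u₀ x, c k t = ∫ t in (0:ℝ)..u₀ x, (1:ℝ) := by
    apply intervalIntegral.integral_congr
    intro t ht
    refine (hc k).2.2.2 t (le_trans ?_ hkN)
    have := abs_sub_left_of_mem_uIcc ht
    simpa using this
  rw [e1, (hc k).2.2.2 _ hkN]
  simp

theorem slice {n : ℕ} {K S : Set (Rn1 n)} (hK : IsCompact K) (hS : S ⊆ K) :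
    ∃ w : Rn n → ℝ, Integrable w ∧ (∀ x, x ∉ Prod.fst '' K → w x = 0) ∧
      ∀ f : Rn n → ℝ, Continuous f → Integrable (fun x => w x * f x) ∧
        ∫ z in S, f z.1 = ∫ x, w x * f x := by
  set T := K ∩ toMeasurable volume S with hT
  have hTm : MeasurableSet T := hK.measurableSet.inter (measurableSet_toMeasurable _ _)
  have hfin : volume S ≠ ⊤ := ((measure_mono hS).trans_lt hK.measure_lt_top).ne
  have hr : volume.restrict S = volume.restrict T := by
    rw [hT, ← Measure.restrict_restrict hK.measurableSet, Measure.restrict_toMeasurable hfin,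
      Measure.restrict_restrict hK.measurableSet, inter_eq_self_of_subset_right hS]
  have hind : ∀ f : Rn n → ℝ, Continuous f →
      Integrable (T.indicator fun z => f z.1) ((volume : Measure (Rn n)).prod volume) := by
    intro f hf
    rw [← Measure.volume_eq_prod, integrable_indicator_iff hTm]
    exact ((hf.comp continuous_fst).continuousOn.integrableOn_compact hK).mono_set inter_subset_left
  have hp : ∀ (f : Rn n → ℝ) x, ∫ t, T.indicator (fun z => f z.1) (x, t) =
      (∫ t, T.indicator (fun _ => (1:ℝ)) (x, t)) * f x := by
    intro f x
    rw [← integral_mul_const]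
    congr 1
    funext t
    by_cases h : (x, t) ∈ T <;> simp [h]
  refine ⟨fun x => ∫ t, T.indicator (fun _ => (1:ℝ)) (x, t), ?_, ?_, ?_⟩
  · exact (hind (fun _ => 1) continuous_const).integral_prod_left
  · intro x hx
    have : ∀ t, T.indicator (fun _ => (1:ℝ)) (x, t) = 0 := fun t =>
      indicator_of_notMem (fun h => hx ⟨_, h.1, rfl⟩) _
    simp [this]
  · intro f hf
    have h1 := (hind f hf).integral_prod_left
    simp_rw [hp] at h1
    refine ⟨h1, ?_⟩
    rw [hr, ← integral_indicator hTm, Measure.volume_eq_prod, integral_prod _ (hind f hf)]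
    simp_rw [hp]

theorem lemmaC {n : ℕ} {K E F : Set (Rn1 n)} (hK : IsCompact K) (hEF : E \ K = F \ K) :
    ∃ w : Rn n → ℝ, Integrable w ∧ (∀ x, x ∉ Prod.fst '' K → w x = 0) ∧
      ∀ (G : Rn1 n → ℝ) (f : Rn n → ℝ), Continuous f → Integrable G → (∀ z ∈ K, G z = f z.1) →
        (∫ z in F, G z) - ∫ z in E, G z = ∫ x, w x * f x := by
  obtain ⟨w₁, h1, h1', h1''⟩ := slice hK (inter_subset_right : F ∩ K ⊆ K)
  obtain ⟨w₂, h2, h2', h2''⟩ := slice hK (inter_subset_right : E ∩ K ⊆ K)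
  refine ⟨fun x => w₁ x - w₂ x, h1.sub h2, fun x hx => by simp [h1' x hx, h2' x hx], ?_⟩
  intro G f hf hG hGf
  have key : ∀ S : Set (Rn1 n), ∫ z in S ∩ K, G z = ∫ z in S ∩ K, f z.1 := by
    intro S
    apply integral_congr_ae
    have h3 : ∀ᵐ z ∂((volume.restrict S).restrict K), z ∈ K := ae_restrict_mem hK.measurableSet
    rw [Measure.restrict_restrict hK.measurableSet, inter_comm] at h3
    filter_upwards [h3] with z hz
    exact hGf z hz
  rw [← integral_inter_add_sdiff (s := F) hK.measurableSet hG.integrableOn,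
    ← integral_inter_add_sdiff (s := E) hK.measurableSet hG.integrableOn, hEF, key, key,
    (h1'' f hf).2, (h2'' f hf).2]
  simp_rw [sub_mul]
  rw [integral_sub (h1'' f hf).1 (h2'' f hf).1]
  ring

open MeasureTheory Set Filter
open scoped Topology

theorem fst_tsupport {n : ℕ} (ζ : Rn n → Rn1 n) : tsupport (fun y => (ζ y).1) ⊆ tsupport ζ :=
  closure_mono (fun y (hy : (ζ y).1 ≠ 0) (h' : ζ y = 0) => hy (by simp [h']))

theorem csmul_tsupport {n : ℕ} (c : ℝ) (ζ : Rn1 n → Rn1 n) :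
    tsupport (fun y => c • ζ y) ⊆ tsupport ζ :=
  closure_mono (fun y (hy : c • ζ y ≠ 0) (h' : ζ y = 0) => hy (by simp [h']))

theorem mul_divN_integrableOn {n : ℕ} {A : Set (Rn n)} {u : Rn n → ℝ} (hu : IntegrableOn u A)
    {η : Rn n → Rn n} (h : ContDiff ℝ 1 η) (hc : HasCompactSupport η) :
    IntegrableOn (fun x => u x * divN η x) A := by
  obtain ⟨C, hC⟩ := (divN_hasCompactSupport hc).exists_bound_of_continuous (divN_continuous h)
  exact hu.mul_bdd (c := C) (divN_continuous h).aestronglyMeasurable (ae_of_all _ hC)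

theorem Gset_bdd {n : ℕ} {Φ : Rn1 n → ℝ} (hΦ : IsNorm1 Φ) {Ω A : Set (Rn n)} {u : Rn n → ℝ}
    (hu : BVlocFun Ω u) (hA : CpCtd A Ω) : BddAbove (Gset Φ A u) := by
  obtain ⟨M, hM⟩ := hu.2 A hA
  obtain ⟨c, hc, hcb⟩ := norm1_lower hΦ
  refine ⟨M / c + (volume A).toReal * (1 / c), ?_⟩
  rintro r ⟨η, h1, h2, h3, h4, rfl⟩
  have hη1 : ContDiff ℝ 1 fun y => (η y).1 := h1.fst
  have hη1c : HasCompactSupport fun y => (η y).1 := h2.comp_left (g := Prod.fst) rfl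
  have hη2c : HasCompactSupport fun y => (η y).2 := h2.comp_left (g := Prod.snd) rfl
  have hint := mul_divN_integrableOn (hu.1 A hA) hη1 hη1c
  have hint2 : IntegrableOn (fun x => (η x).2) A :=
    (h1.continuous.snd.integrable_of_hasCompactSupport hη2c).integrableOn
  have hAfin : volume A < ⊤ := (measure_mono subset_closure).trans_lt hA.2.1.measure_lt_top
  rw [integral_add hint hint2]
  have hb : ∀ x, c * ‖(η x).1‖ ≤ 1 ∧ c * |(η x).2| ≤ 1 := by
    intro x
    have h5 := (norm_le_enorm1 _).trans (hcb _ (h4 x))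
    rw [norm_smul, Real.norm_eq_abs, abs_of_pos hc] at h5
    exact ⟨le_trans (by gcongr; exact norm_fst_le _) h5,
      le_trans (by gcongr; exact norm_snd_le (η x)) h5⟩
  refine add_le_add ?_ ?_
  · rw [le_div_iff₀ hc]
    refine hM ⟨fun x => c • (η x).1, ⟨hη1.const_smul c, hη1c.smul_left (f := fun _ => c),
      ?_, ?_⟩, ?_⟩
    · exact (closure_mono (Function.support_const_smul_subset c _)).trans
        ((fst_tsupport η).trans h3)
    · intro x
      show ‖c • (η x).1‖ ≤ 1
      rw [norm_smul, Real.norm_eq_abs, abs_of_pos hc]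
      exact (hb x).1
    · rw [divN_smul hη1, mul_comm, ← integral_const_mul]
      congr 1
      funext x
      ring
  · have h6 : ∫ x in A, (η x).2 ≤ ∫ x in A, (1 / c : ℝ) := by
      refine integral_mono hint2 (integrableOn_const hAfin.ne) fun x => ?_
      show (η x).2 ≤ 1 / c
      rw [le_div_iff₀ hc, mul_comm]
      exact (mul_le_mul_of_nonneg_left (le_abs_self _) hc.le).trans (hb x).2
    rw [setIntegral_const] at h6
    simpa [Measure.real] using h6

theorem exists_base {n : ℕ} {Ω : Set (Rn n)} (hΩ : IsOpen Ω) {A : Set (Rn1 n)}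
    (hA : CpCtd A (Ω ×ˢ (univ : Set ℝ))) :
    ∃ V, CpCtd V Ω ∧ Prod.fst '' closure A ⊆ V := by
  have h : Prod.fst '' closure A ⊆ Ω := by
    rintro _ ⟨z, hz, rfl⟩
    exact (hA.2.2 hz).1
  obtain ⟨V, h1, h2, h3, h4⟩ :=
    exists_open_between_and_isCompact_closure (hA.2.1.image continuous_fst) hΩ h
  exact ⟨V, ⟨h1, h4, h3⟩, h2⟩

theorem sg_bdd {n : ℕ} {Φ : Rn1 n → ℝ} (hΦ : IsNorm1 Φ) {Ω V : Set (Rn n)} {u : Rn n → ℝ}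
    (hu : BVlocFun Ω u) (hV : CpCtd V Ω) :
    BddAbove (perSet1 Φ (sg Ω u) (V ×ˢ (univ : Set ℝ))) := by
  obtain ⟨M, hM⟩ := Gset_bdd hΦ hu hV
  refine ⟨M, ?_⟩
  rintro r ⟨η, hη, rfl⟩
  exact lemmaA hΦ hV.1 (subset_closure.trans hV.2.2) (hu.1 V hV) hM hη

theorem sub_cyl {n : ℕ} {A : Set (Rn1 n)} {V : Set (Rn n)} (h : Prod.fst '' closure A ⊆ V) :
    A ⊆ V ×ˢ (univ : Set ℝ) := fun z hz => ⟨h ⟨z, subset_closure hz, rfl⟩, mem_univ _⟩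

theorem sg_BVloc {n : ℕ} {Φ : Rn1 n → ℝ} (hΦ : IsNorm1 Φ) {Ω : Set (Rn n)} (hΩ : IsOpen Ω)
    {u : Rn n → ℝ} (hu : BVlocFun Ω u) : BVlocSet1 (Ω ×ˢ (univ : Set ℝ)) (sg Ω u) := by
  intro A hA
  obtain ⟨V, hV, hAV⟩ := exists_base hΩ hA
  obtain ⟨c, hc, h⟩ := norm1_upper hΦ
  exact bdd_scale hc h ((sg_bdd hΦ hu hV).mono (perSet1_mono (sub_cyl hAV)))

theorem wkey {n : ℕ} {K E F : Set (Rn1 n)} (hK : IsCompact K) (hEF : E \ K = F \ K) :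
    ∃ w : Rn n → ℝ, Integrable w ∧ (∀ x, x ∉ Prod.fst '' K → w x = 0) ∧ ∃ R : ℝ,
      ∀ c : ℝ → ℝ, ContDiff ℝ 1 c → HasCompactSupport c → (∀ t, |t| ≤ R → c t = 1) →
      ∀ ζ : Rn n → Rn1 n, ContDiff ℝ 1 ζ → HasCompactSupport ζ →
        DD F (pf c ζ) - DD E (pf c ζ) = ∫ x, w x * divN (fun y => (ζ y).1) x := by
  obtain ⟨w, h1, h2, h3⟩ := lemmaC hK hEF
  obtain ⟨R, hR⟩ := hK.isBounded.exists_norm_le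
  refine ⟨w, h1, h2, R + 1, fun c hc hcc hc1 ζ hζ hζc => ?_⟩
  have hd : ∀ S, DD S (pf c ζ) = ∫ z in S, - div1 (pf c ζ) z := fun S => by
    unfold DD; rw [integral_neg]
  rw [hd, hd]
  refine h3 _ _ (divN_continuous hζ.fst)
    (div1_integrable (pf_contDiff hc hζ) (pf_hasCompactSupport hcc hζc)).neg fun z hz => ?_
  have hz2 : |z.2| < R + 1 := by
    have := (norm_snd_le z).trans (hR z hz)
    rw [Real.norm_eq_abs] at this
    linarith
  have he : c =ᶠ[𝓝 z.2] fun _ => 1 := by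
    have : ∀ᶠ t in 𝓝 z.2, |t| < R + 1 :=
      continuous_abs.continuousAt.eventually_lt continuousAt_const hz2
    filter_upwards [this] with t ht using hc1 t ht.le
  rw [pf_div hc hζ, he.deriv_eq, hc1 _ hz2.le]
  simp

theorem pf_test {n : ℕ} {Φ : Rn1 n → ℝ} (hΦ : ∀ (c : ℝ) (ξ : Rn1 n), Φ (c • ξ) = |c| * Φ ξ)
    {c : ℝ → ℝ} {ζ : Rn n → Rn1 n}
    (hc : ContDiff ℝ 1 c) (hcc : HasCompactSupport c) (hc1 : ∀ t, c t ∈ Icc (0:ℝ) 1)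
    (hζ : ContDiff ℝ 1 ζ) (hζc : HasCompactSupport ζ) (hb : ∀ x, Φ (ζ x) ≤ 1)
    {W : Set (Rn1 n)} (hW : tsupport ζ ×ˢ tsupport c ⊆ W) : Test1 W Φ (pf c ζ) := by
  refine ⟨pf_contDiff hc hζ, pf_hasCompactSupport hcc hζc, (pf_tsupport c ζ).trans hW, fun z => ?_⟩
  unfold pf
  rw [hΦ, abs_neg, abs_of_nonneg (hc1 _).1]
  calc c z.2 * Φ (ζ z.1) ≤ c z.2 * 1 := mul_le_mul_of_nonneg_left (hb _) (hc1 _).1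
    _ ≤ 1 := by linarith [(hc1 z.2).2]

theorem v_BVloc {n : ℕ} {Ω : Set (Rn n)} {u w : Rn n → ℝ}
    (hu : BVlocFun Ω u) {E F : Set (Rn1 n)} (hE : BVlocSet1 (Ω ×ˢ (univ : Set ℝ)) E)
    (hF : BVlocSet1 (Ω ×ˢ (univ : Set ℝ)) F) (hw : Integrable w) {R : ℝ}
    (hR : ∀ c : ℝ → ℝ, ContDiff ℝ 1 c → HasCompactSupport c → (∀ t, |t| ≤ R → c t = 1) →
      ∀ ζ : Rn n → Rn1 n, ContDiff ℝ 1 ζ → HasCompactSupport ζ →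
        DD F (pf c ζ) - DD E (pf c ζ) = ∫ x, w x * divN (fun y => (ζ y).1) x) :
    BVlocFun Ω (fun x => u x + w x) := by
  refine ⟨fun A hA => (hu.1 A hA).add hw.integrableOn, fun A hA => ?_⟩
  obtain ⟨c, hc⟩ := exists_cutoffs
  obtain ⟨k, hk⟩ := exists_nat_ge R
  obtain ⟨hc1, hc2, hc3, hc4⟩ := hc k
  obtain ⟨T, hT⟩ := hc2.isBounded.subset_ball (0:ℝ)
  have hB : CpCtd (A ×ˢ Metric.ball (0:ℝ) T) (Ω ×ˢ (univ : Set ℝ)) := by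
    refine ⟨hA.1.prod Metric.isOpen_ball, ?_, ?_⟩ <;> rw [closure_prod_eq]
    · exact hA.2.1.prod (Metric.isBounded_ball.isCompact_closure)
    · exact prod_mono hA.2.2 (subset_univ _)
  obtain ⟨M, hM⟩ := hu.2 A hA
  obtain ⟨M1, hM1⟩ := hE _ hB
  obtain ⟨M2, hM2⟩ := hF _ hB
  refine ⟨M + (M2 + M1), ?_⟩
  rintro r ⟨η, ⟨h1, h2, h3, h4⟩, rfl⟩
  have hint := mul_divN_integrableOn (hu.1 A hA) h1 h2
  have hintw := mul_divN_integrableOn (hw.integrableOn (s := A)) h1 h2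
  have e : ∫ x in A, (u x + w x) * divN η x
      = (∫ x in A, u x * divN η x) + ∫ x in A, w x * divN η x := by
    rw [← integral_add hint hintw]
    congr 1; funext x; ring
  rw [e]
  refine add_le_add (hM ⟨η, ⟨h1, h2, h3, h4⟩, rfl⟩) ?_
  have e2 : ∫ x in A, w x * divN η x = ∫ x, w x * divN η x := by
    apply setIntegral_eq_integral_of_forall_compl_eq_zero
    intro x hx
    rw [divN_zero_of_notMem fun h => hx (h3 h), mul_zero]
  rw [e2]
  set ζ : Rn n → Rn1 n := fun x => (η x, 0) with hζdef
  have hζ : ContDiff ℝ 1 ζ := h1.prodMk contDiff_const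
  have hts : tsupport ζ ⊆ tsupport η :=
    closure_mono (fun y (hy : ζ y ≠ 0) (h' : η y = 0) => hy (by simp [hζdef, h']))
  have hζc : HasCompactSupport ζ := IsCompact.of_isClosed_subset h2 (isClosed_tsupport _) hts
  have hb : ∀ x, enorm1 (ζ x) ≤ 1 := fun x => by
    have := enorm1_le (ζ x)
    have h5 := h4 x
    simp only [hζdef, abs_zero, add_zero] at this h5 ⊢
    exact this.trans h5
  have ht : Test1 (A ×ˢ Metric.ball (0:ℝ) T) enorm1 (pf (c k) ζ) :=
    pf_test enorm1_smul hc1 hc2 hc3 hζ hζc hb (prod_mono (hts.trans h3) hT)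
  have ht' : Test1 (A ×ˢ Metric.ball (0:ℝ) T) enorm1 (fun z => (-1:ℝ) • pf (c k) ζ z) := by
    refine ⟨ht.1.const_smul (-1:ℝ), ht.2.1.smul_left (f := fun _ => (-1:ℝ)),
      (csmul_tsupport _ _).trans ht.2.2.1, fun z => ?_⟩
    rw [enorm1_smul]; simpa using ht.2.2.2 z
  have h6 := hR (c k) hc1 hc2 (fun t h => hc4 t (by linarith)) ζ hζ hζc
  have h7 : DD F (pf (c k) ζ) ≤ M2 := hM2 ⟨_, ht, rfl⟩
  have h8 : DD E (fun z => (-1:ℝ) • pf (c k) ζ z) ≤ M1 := hM1 ⟨_, ht', rfl⟩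
  rw [DD_smul E ht.1] at h8
  change _ = ∫ x, w x * divN η x at h6
  linarith

theorem minPer_subgraph_of_minG {n : ℕ} (Φ : Rn1 n → ℝ) (hΦ : IsNorm1 Φ)
    (hmono : PartMono Φ) (Ω : Set (Rn n)) (hΩ : IsOpen Ω) (u : Rn n → ℝ)
    (hmin : MinG Φ Ω u) :
    MinPer1 Φ (Ω ×ˢ (univ : Set ℝ)) (sg Ω u) := by
  obtain ⟨hu, hmin⟩ := hmin
  have hE := sg_BVloc hΦ hΩ hu
  refine ⟨hE, fun A hA F hF hK hKA => ?_⟩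
  obtain ⟨V, hV, hAV⟩ := exists_base hΩ hA
  set K := closure (symmDiff (sg Ω u) F) with hKdef
  have hEF : sg Ω u \ K = F \ K := by
    ext z
    have : z ∈ symmDiff (sg Ω u) F → z ∈ K := fun h => subset_closure h
    rw [mem_symmDiff] at this
    simp only [Set.mem_sdiff]
    tauto
  obtain ⟨w, hw, hw0, R, hR⟩ := wkey hK hEF
  have hv := v_BVloc hu hE hF hw hR
  have hVΩ : V ⊆ Ω := subset_closure.trans hV.2.2
  have hKV : Prod.fst '' K ⊆ V := (image_mono (hKA.trans subset_closure)).trans hAV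
  have hKc : IsCompact (Prod.fst '' K) := hK.image continuous_fst
  have hts : tsupport (fun x => u x - (u x + w x)) ⊆ Prod.fst '' K := by
    refine closure_minimal (fun x hx => ?_) hKc.isClosed
    by_contra h
    exact hx (by simp [hw0 x h])
  have hG : Gfun Φ u V ≤ Gfun Φ (fun x => u x + w x) V := hmin V hV _ hv
    ⟨hKc.of_isClosed_subset (isClosed_tsupport _) hts, hts.trans hKV⟩
  obtain ⟨cl, hcl, hclb⟩ := norm1_lower hΦ
  refine localize hΦ hK hKA hA.1 (sub_cyl hAV) hEF (sg_bdd hΦ hu hV)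
    (bdd_scale hcl hclb (hF A hA)) fun η hη ε hε => ?_
  have h1 : DD (sg Ω u) η ≤ Gfun Φ u V :=
    lemmaA hΦ hV.1 hVΩ (hu.1 V hV) (fun r hr => le_csSup (Gset_bdd hΦ hu hV) hr) hη
  have hne : (Gset Φ V (fun x => u x + w x)).Nonempty :=
    ⟨_, fun _ => 0, contDiff_const, HasCompactSupport.zero, by simp [tsupport],
      fun _ => by rw [norm1_zero hΦ]; norm_num, rfl⟩
  obtain ⟨r, ⟨ζ, hζ, hζc, hζV, hζΦ, rfl⟩, hr⟩ :=
    exists_lt_of_lt_csSup hne (show Gfun Φ (fun x => u x + w x) V - ε / 2 < _ from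
      sub_lt_self _ (half_pos hε))
  have hζ1 : ContDiff ℝ 1 fun y => (ζ y).1 := hζ.fst
  have hζ1c : HasCompactSupport fun y => (ζ y).1 := hζc.comp_left (g := Prod.fst) rfl
  have hζ2c : HasCompactSupport fun y => (ζ y).2 := hζc.comp_left (g := Prod.snd) rfl
  have hint := mul_divN_integrableOn (hu.1 V hV) hζ1 hζ1c
  have hintw := mul_divN_integrableOn (hw.integrableOn (s := V)) hζ1 hζ1c
  have hint2 : IntegrableOn (fun x => (ζ x).2) V :=
    (hζ.continuous.snd.integrable_of_hasCompactSupport hζ2c).integrableOn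
  have e : ∫ x in V, ((u x + w x) * divN (fun y => (ζ y).1) x + (ζ x).2)
      = (∫ x in V, (u x * divN (fun y => (ζ y).1) x + (ζ x).2))
        + ∫ x in V, w x * divN (fun y => (ζ y).1) x := by
    have hs : IntegrableOn (fun x => u x * divN (fun y => (ζ y).1) x + (ζ x).2) V := hint.add hint2
    rw [← integral_add hs hintw]
    congr 1; funext x; ring
  have e2 : ∫ x in V, w x * divN (fun y => (ζ y).1) x
      = ∫ x, w x * divN (fun y => (ζ y).1) x := by
    apply setIntegral_eq_integral_of_forall_compl_eq_zero
    intro x hx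
    rw [divN_zero_of_notMem fun h => hx (hζV (fst_tsupport ζ h)), mul_zero]
  rw [e, e2] at hr
  obtain ⟨c, hc⟩ := exists_cutoffs
  have hB := lemmaB hV.1 hVΩ (hu.1 V hV) hc hζ hζc hζV
  obtain ⟨k₀, hk₀⟩ := exists_nat_ge R
  obtain ⟨k, hk, hkk⟩ := ((hB.eventually (lt_mem_nhds
    (sub_lt_self _ (half_pos hε)))).and (eventually_ge_atTop k₀)).exists
  obtain ⟨hc1, hc2, hc3, hc4⟩ := hc k
  refine ⟨pf (c k) ζ, pf_test hΦ.2.1 hc1 hc2 hc3 hζ hζc hζΦ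
    (prod_mono hζV (subset_univ _)), ?_⟩
  have hkk' : (k₀ : ℝ) ≤ k := by exact_mod_cast hkk
  have h6 := hR (c k) hc1 hc2 (fun t h => hc4 t (by linarith)) ζ hζ hζc
  linarith
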